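/- arXiv:2310.04962 — 5 statements merged into one kernel-verified Lean document; each statement's English description precedes it below -/
import Mathlib

section
/- Let t ≥ 3 be an integer. Every edge-colored complete balanced bipartite graph K^c_{n,n} with minimum color degree δ^c(K^c_{n,n}) ≥ 2n/3 + t contains a properly colored 2-factor H such that every cycle of H has length at least t. -/
open SimpleGraph

/-- Vertex type of `K_{n,n}`: left part `X`, right part `Y`. -/
abbrev V2 (n : ℕ) := Fin n ⊕ Fin n

/-- The complete balanced bipartite graph `K_{n,n}`. -/
def KBB (n : ℕ) : SimpleGraph (V2 n) := completeBipartiteGraph (Fin n) (Fin n)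

/-- The color degree of a vertex: the number of distinct colors on its incident edges. -/
def colorDeg (n : ℕ) (c : V2 n → V2 n → ℕ) : V2 n → ℕ
  | Sum.inl x => ((Finset.univ : Finset (Fin n)).image fun j => c (Sum.inl x) (Sum.inr j)).card
  | Sum.inr y => ((Finset.univ : Finset (Fin n)).image fun i => c (Sum.inr y) (Sum.inl i)).card

/-- The minimum color degree `δ^c`. -/
noncomputable def minColorDeg (n : ℕ) (c : V2 n → V2 n → ℕ) : ℕ :=
  ⨅ v : V2 n, colorDeg n c v

/-- `Δ_mon(v)`: the maximum number of same-colored edges incident to `v`. -/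
def monDeg (n : ℕ) (c : V2 n → V2 n → ℕ) : V2 n → ℕ
  | Sum.inl x => Finset.univ.sup fun j : Fin n =>
      (Finset.univ.filter fun j' : Fin n =>
        c (Sum.inl x) (Sum.inr j') = c (Sum.inl x) (Sum.inr j)).card
  | Sum.inr y => Finset.univ.sup fun i : Fin n =>
      (Finset.univ.filter fun i' : Fin n =>
        c (Sum.inr y) (Sum.inl i') = c (Sum.inr y) (Sum.inl i)).card

/-- A subgraph is properly colored: adjacent edges receive distinct colors. -/
def IsPCSubgraph (n : ℕ) (c : V2 n → V2 n → ℕ) (H : SimpleGraph (V2 n)) : Prop :=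
  ∀ u v w, H.Adj u v → H.Adj u w → v ≠ w → c u v ≠ c u w

/-- Every cycle of `H` has length at least `t`. -/
def CyclesAtLeast {n : ℕ} (H : SimpleGraph (V2 n)) (t : ℕ) : Prop :=
  ∀ (v : V2 n) (p : H.Walk v v), p.IsCycle → t ≤ p.length

/-- A properly colored 2-factor of `K_{n,n}`: a spanning 2-regular properly colored
subgraph. -/
def IsPC2Factor (n : ℕ) (c : V2 n → V2 n → ℕ) (H : SimpleGraph (V2 n)) : Prop :=
  H ≤ KBB n ∧ (∀ v, (H.neighborSet v).ncard = 2) ∧ IsPCSubgraph n c H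

/-- A properly colored `2^{(t)}`-factor of the induced subgraph on `S`. -/
def IsPC2FactorOn (n : ℕ) (c : V2 n → V2 n → ℕ) (S : Set (V2 n))
    (H : SimpleGraph (V2 n)) (t : ℕ) : Prop :=
  H ≤ KBB n ∧ (∀ u v, H.Adj u v → u ∈ S) ∧ (∀ v ∈ S, (H.neighborSet v).ncard = 2) ∧
    IsPCSubgraph n c H ∧ CyclesAtLeast H t

/-- A properly colored cycle of length `k` in `K_{n,n}`, given as an injective cyclic
sequence of vertices with adjacent edges having distinct colors. -/
def IsPCCycle (n : ℕ) (c : V2 n → V2 n → ℕ) (k : ℕ) (f : ZMod k → V2 n) : Prop :=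
  Function.Injective f ∧ (∀ i, (KBB n).Adj (f i) (f (i + 1))) ∧
    ∀ i, c (f i) (f (i + 1)) ≠ c (f (i + 1)) (f (i + 2))

/-- Consecutive edges of the vertex list receive distinct colors. -/
def PCL (n : ℕ) (c : V2 n → V2 n → ℕ) : List (V2 n) → Prop
  | a :: b :: d :: rest => c a b ≠ c b d ∧ PCL n c (b :: d :: rest)
  | _ => True

/-- A properly colored path in `K_{n,n}` given by its list of vertices. -/
def IsPCPath (n : ℕ) (c : V2 n → V2 n → ℕ) (l : List (V2 n)) : Prop :=
  l ≠ [] ∧ l.Nodup ∧ l.Chain' (KBB n).Adj ∧ PCL n c l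

/-- A properly colored odd path: odd number of edges, i.e. an even number of vertices,
equivalently one endpoint in each part. -/
def IsPCOddPath (n : ℕ) (c : V2 n → V2 n → ℕ) (l : List (V2 n)) : Prop :=
  IsPCPath n c l ∧ Even l.length

/-- A properly colored 3-path `x' y' x'' y''` with `x', x'' ∈ X` and `y', y'' ∈ Y`,
encoded as the quadruple `(x', y', x'', y'')`. -/
def IsPC3Path (n : ℕ) (c : V2 n → V2 n → ℕ) : Fin n × Fin n × Fin n × Fin n → Prop
  | (a, b, a', b') =>
    a ≠ a' ∧ b ≠ b' ∧
      c (Sum.inl a) (Sum.inr b) ≠ c (Sum.inr b) (Sum.inl a') ∧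
      c (Sum.inr b) (Sum.inl a') ≠ c (Sum.inl a') (Sum.inr b')

/-- An absorbing path `x' y' x'' y''` for the pair `(x, y)`: a PC 3-path avoiding
`{x, y}` such that `x' y' x y x'' y''` is a properly colored path. -/
def IsAbsorbingPath1 (n : ℕ) (c : V2 n → V2 n → ℕ) (x y : Fin n) :
    Fin n × Fin n × Fin n × Fin n → Prop
  | (a, b, a', b') =>
    IsPC3Path n c (a, b, a', b') ∧
      a ≠ x ∧ a' ≠ x ∧ b ≠ y ∧ b' ≠ y ∧
      c (Sum.inl a) (Sum.inr b) ≠ c (Sum.inr b) (Sum.inl x) ∧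
      c (Sum.inr b) (Sum.inl x) ≠ c (Sum.inl x) (Sum.inr y) ∧
      c (Sum.inl x) (Sum.inr y) ≠ c (Sum.inr y) (Sum.inl a') ∧
      c (Sum.inr y) (Sum.inl a') ≠ c (Sum.inl a') (Sum.inr b')

/-- An absorbing path `x' y' x'' y''` for the quadruple `(x₁, y₁; x₂, y₂)`: a PC 3-path
avoiding `{x₁, y₁, x₂, y₂}` such that the paths `x' y' x₁ y₁` and `y'' x'' y₂ x₂`
are properly colored. -/
def IsAbsorbingPath2 (n : ℕ) (c : V2 n → V2 n → ℕ) (x₁ y₁ x₂ y₂ : Fin n) :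
    Fin n × Fin n × Fin n × Fin n → Prop
  | (a, b, a', b') =>
    IsPC3Path n c (a, b, a', b') ∧
      a ≠ x₁ ∧ a ≠ x₂ ∧ a' ≠ x₁ ∧ a' ≠ x₂ ∧ b ≠ y₁ ∧ b ≠ y₂ ∧ b' ≠ y₁ ∧ b' ≠ y₂ ∧
      c (Sum.inl a) (Sum.inr b) ≠ c (Sum.inr b) (Sum.inl x₁) ∧
      c (Sum.inr b) (Sum.inl x₁) ≠ c (Sum.inl x₁) (Sum.inr y₁) ∧
      c (Sum.inr b') (Sum.inl a') ≠ c (Sum.inl a') (Sum.inr y₂) ∧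
      c (Sum.inl a') (Sum.inr y₂) ≠ c (Sum.inr y₂) (Sum.inl x₂)

/-- Two 3-paths (as quadruples) are vertex-disjoint. -/
def QuadDisjoint {n : ℕ} (P Q : Fin n × Fin n × Fin n × Fin n) : Prop :=
  P.1 ≠ Q.1 ∧ P.1 ≠ Q.2.2.1 ∧ P.2.2.1 ≠ Q.1 ∧ P.2.2.1 ≠ Q.2.2.1 ∧
    P.2.1 ≠ Q.2.1 ∧ P.2.1 ≠ Q.2.2.2 ∧ P.2.2.2 ≠ Q.2.1 ∧ P.2.2.2 ≠ Q.2.2.2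

/-- A `1^{(t)}`-path-cycle: a vertex-disjoint union of exactly one PC path and a
(possibly empty) collection of PC cycles, each cycle of length at least `t`. -/
structure OnePathCycleT (n : ℕ) (c : V2 n → V2 n → ℕ) (t : ℕ) where
  path : List (V2 n)
  path_pc : IsPCPath n c path
  numCycles : ℕ
  cycLen : Fin numCycles → ℕ
  cyc : (i : Fin numCycles) → ZMod (cycLen i) → V2 n
  cyc_pc : ∀ i, IsPCCycle n c (cycLen i) (cyc i)
  cyc_long : ∀ i, t ≤ cycLen i
  disj_path_cyc : ∀ i j, cyc i j ∉ path
  disj_cyc_cyc : ∀ i i', i ≠ i' → ∀ j j', cyc i j ≠ cyc i' j'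

/-- The vertex set of a `1^{(t)}`-path-cycle. -/
def OnePathCycleT.verts {n : ℕ} {c : V2 n → V2 n → ℕ} {t : ℕ}
    (H : OnePathCycleT n c t) : Set (V2 n) :=
  {v | v ∈ H.path} ∪ ⋃ i, Set.range (H.cyc i)

section LinearForests

variable {V : Type*}

/-- Every walk of `H` from `u` to `v` has length at least `r`. -/
def WalkFar (H : SimpleGraph V) (r : ℕ) (u v : V) : Prop :=
  ∀ p : H.Walk u v, r ≤ p.length

/-- Every cycle of `H` has length at least `t`, over an arbitrary vertex type. -/
def LongCycles (H : SimpleGraph V) (t : ℕ) : Prop :=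
  ∀ (v : V) (p : H.Walk v v), p.IsCycle → t ≤ p.length

namespace WalkFar

variable {H K : SimpleGraph V} {r s : ℕ} {u v w : V}

lemma symm (h : WalkFar H r u v) : WalkFar H r v u := fun p ↦ by
  simpa using h p.reverse

lemma anti (hK : K ≤ H) (h : WalkFar H r u v) : WalkFar K r u v := fun p ↦ by
  simpa using h (p.mapLe hK)

lemma mono (hs : s ≤ r) (h : WalkFar H r u v) : WalkFar H s u v := fun p ↦ hs.trans (h p)

lemma one_of_ne (h : u ≠ v) : WalkFar H 1 u v := fun p ↦ by
  by_contra! hp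
  exact h (Walk.eq_of_length_eq_zero (by omega : p.length = 0))

lemma ne (hr : 1 ≤ r) (h : WalkFar H r u v) : u ≠ v := by
  rintro rfl
  have := h Walk.nil
  simp at this
  omega

lemma not_adj (hr : 2 ≤ r) (h : WalkFar H r u v) : ¬ H.Adj u v := fun ha ↦ by
  have := h ha.toWalk
  simp at this
  omega

lemma of_adj_left (ha : H.Adj u w) (h : WalkFar H (r + 1) u v) : WalkFar H r w v := fun p ↦ by
  simpa using h (Walk.cons ha p)

lemma of_adj_right (ha : H.Adj v w) (h : WalkFar H (r + 1) u v) : WalkFar H r u w :=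
  (h.symm.of_adj_left ha).symm

end WalkFar

lemma exists_walk_of_walk_sup_edge {K : SimpleGraph V} {x b p q : V}
    (w : (K ⊔ edge x b).Walk p q) :
    (∃ w' : K.Walk p q, w'.length ≤ w.length) ∨
    (∃ (w₁ : K.Walk p x) (w₂ : K.Walk b q), w₁.length + 1 + w₂.length ≤ w.length) ∨
    (∃ (w₁ : K.Walk p b) (w₂ : K.Walk x q), w₁.length + 1 + w₂.length ≤ w.length) := by
  induction w with
  | nil => exact Or.inl ⟨Walk.nil, le_rfl⟩
  | @cons p p' q h w ih =>
    rw [sup_adj, edge_adj] at h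
    rcases h with h | ⟨⟨rfl, rfl⟩ | ⟨rfl, rfl⟩, -⟩
    · rcases ih with ⟨w', hw⟩ | ⟨w₁, w₂, hw⟩ | ⟨w₁, w₂, hw⟩
      · exact Or.inl ⟨Walk.cons h w', by simpa using hw⟩
      · exact Or.inr (Or.inl ⟨Walk.cons h w₁, w₂, by simp; omega⟩)
      · exact Or.inr (Or.inr ⟨Walk.cons h w₁, w₂, by simp; omega⟩)
    · rcases ih with ⟨w', hw⟩ | ⟨w₁, w₂, hw⟩ | ⟨w₁, w₂, hw⟩
      · exact Or.inr (Or.inl ⟨Walk.nil, w', by simp; omega⟩)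
      · exact Or.inr (Or.inl ⟨Walk.nil, w₂, by simp; omega⟩)
      · exact Or.inl ⟨w₂, by simp; omega⟩
    · rcases ih with ⟨w', hw⟩ | ⟨w₁, w₂, hw⟩ | ⟨w₁, w₂, hw⟩
      · exact Or.inr (Or.inr ⟨Walk.nil, w', by simp; omega⟩)
      · exact Or.inl ⟨w₂, by simp; omega⟩
      · exact Or.inr (Or.inr ⟨Walk.nil, w₂, by simp; omega⟩)

lemma WalkFar.sup_edge {K : SimpleGraph V} {x b p q : V} {r i j k l : ℕ}
    (h : WalkFar K r p q)
    (hpx : WalkFar K i p x) (hbq : WalkFar K j b q) (hij : r ≤ i + 1 + j)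
    (hpb : WalkFar K k p b) (hxq : WalkFar K l x q) (hkl : r ≤ k + 1 + l) :
    WalkFar (K ⊔ edge x b) r p q := fun w ↦ by
  rcases exists_walk_of_walk_sup_edge w with ⟨w', hw⟩ | ⟨w₁, w₂, hw⟩ | ⟨w₁, w₂, hw⟩
  · exact (h w').trans hw
  · have := hpx w₁
    have := hbq w₂
    omega
  · have := hpb w₁
    have := hxq w₂
    omega

lemma WalkFar.zero {H : SimpleGraph V} {u v : V} : WalkFar H 0 u v := fun _ ↦ Nat.zero_le _

lemma LongCycles.anti {H K : SimpleGraph V} {t : ℕ} (hK : K ≤ H) (h : LongCycles H t) :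
    LongCycles K t := fun v p hp ↦ by
  simpa using h v (p.mapLe hK) (hp.mapLe hK)

lemma LongCycles.walkFar {H K : SimpleGraph V} {t : ℕ} {a b : V} (h : LongCycles H t)
    (hK : K ≤ H) (hab : H.Adj a b) (hKab : ¬ K.Adj a b) : WalkFar K (t - 1) a b := fun p ↦ by
  classical
  have hp := (p.bypass_isPath).mapLe hK
  have := h b (Walk.cons hab.symm (p.bypass.mapLe hK)) ((Walk.cons_isCycle_iff _ _).2 ⟨hp, by
    intro hmem
    simp only [Walk.edges_mapLe_eq_edges] at hmem
    exact hKab (Walk.adj_of_mem_edges _ hmem).symm⟩)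
  have h2 := p.length_bypass_le_length
  simp at this
  omega

lemma LongCycles.sup_edge {K : SimpleGraph V} {t : ℕ} {u v : V} (h : LongCycles K t)
    (ht : 2 ≤ t) (hf : WalkFar K (t - 1) u v) : LongCycles (K ⊔ edge u v) t := by
  classical
  intro z p hp
  have huv : u ≠ v := hf.ne (by omega)
  have key : ∀ {z x : V} (q : (K ⊔ edge u v).Walk z x), s(u, v) ∉ q.edges →
      ∃ q' : K.Walk z x, q'.length = q.length ∧ q'.edges = q.edges := by
    intro z x q hq
    have hK : ∀ e ∈ q.edges, e ∈ K.edgeSet := by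
      intro e he
      have := Walk.edges_subset_edgeSet _ he
      induction e with | _ e₁ e₂ =>
      rw [mem_edgeSet, sup_adj, edge_adj] at this
      rcases this with h' | ⟨⟨rfl, rfl⟩ | ⟨rfl, rfl⟩, -⟩
      · exact h'
      · exact absurd he hq
      · exact absurd (Sym2.eq_swap ▸ he) hq
    exact ⟨q.transfer K hK, Walk.length_transfer _ hK, Walk.edges_transfer _ hK⟩
  by_cases hmem : s(u, v) ∈ p.edges
  · have hu : u ∈ p.support := Walk.fst_mem_support_of_mem_edges _ hmem
    have hv : v ∈ p.support := Walk.snd_mem_support_of_mem_edges _ hmem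
    have hc := hp.rotate hu
    have hv' : v ∈ (p.rotate u hu).support := by
      rw [Walk.mem_support_rotate_iff]; exact hv
    rw [← Walk.length_rotate p u hu]
    generalize p.rotate u hu = q at hc hv'
    cases q with
    | nil => simp at hc
    | @cons _ y _ ha q =>
      rw [Walk.cons_isCycle_iff] at hc
      obtain ⟨hq, hnot⟩ := hc
      by_cases hy : y = v
      · subst hy
        obtain ⟨q', hq', -⟩ := key q hnot
        have := hf.symm q'
        simp; omega
      · have hvq : v ∈ q.support := by
          simpa [huv.symm] using hv'
        have hno := Walk.endpoint_notMem_support_takeUntil hq hvq huv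
        have hlt := Walk.length_takeUntil_lt_length hvq huv.symm
        obtain ⟨q', hq', -⟩ := key (q.takeUntil v hvq)
          (fun hm ↦ hno (Walk.fst_mem_support_of_mem_edges _ hm))
        rw [sup_adj, edge_adj] at ha
        have ha' : K.Adj u y := by grind
        have := hf (Walk.cons ha' q')
        simp at this ⊢
        omega
  · have : ∀ e ∈ p.edges, e ∈ K.edgeSet := by
      intro e he
      obtain ⟨q', -, hq⟩ := key p hmem
      exact Walk.edges_subset_edgeSet q' (hq ▸ he)
    have := h z (p.transfer K this) (hp.transfer this)
    simpa using this

/-- `H` is a properly colored subgraph of `G` of maximum degree at most two all of whose cycles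
have length at least `t`. -/
structure IsLongPathCycle (G : SimpleGraph V) (c : V → V → ℕ) (t : ℕ) (H : SimpleGraph V) :
    Prop where
  le : H ≤ G
  deg : ∀ v z₁ z₂ z₃, H.Adj v z₁ → H.Adj v z₂ → H.Adj v z₃ → z₁ = z₂ ∨ z₁ = z₃ ∨ z₂ = z₃
  pc : ∀ v z₁ z₂, H.Adj v z₁ → H.Adj v z₂ → z₁ ≠ z₂ → c v z₁ ≠ c v z₂
  long : LongCycles H t

variable {G H K : SimpleGraph V} {c : V → V → ℕ} {t : ℕ}

namespace IsLongPathCycle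

lemma anti (hK : K ≤ H) (h : IsLongPathCycle G c t H) : IsLongPathCycle G c t K where
  le := hK.trans h.le
  deg v z₁ z₂ z₃ h₁ h₂ h₃ := h.deg v z₁ z₂ z₃ (hK h₁) (hK h₂) (hK h₃)
  pc v z₁ z₂ h₁ h₂ := h.pc v z₁ z₂ (hK h₁) (hK h₂)
  long := h.long.anti hK

lemma sup_edge (h : IsLongPathCycle G c t K) (hc : ∀ u v, c u v = c v u) (ht : 2 ≤ t) {u v : V}
    (huv : G.Adj u v) (hf : WalkFar K (t - 1) u v)
    (hu : ∀ z z', K.Adj u z → K.Adj u z' → z = z') (hv : ∀ z z', K.Adj v z → K.Adj v z' → z = z')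
    (hcu : ∀ z, K.Adj u z → c u z ≠ c u v) (hcv : ∀ z, K.Adj v z → c v z ≠ c u v) :
    IsLongPathCycle G c t (K ⊔ edge u v) where
  le := sup_le h.le (by rwa [edge_le_iff, or_iff_right huv.ne])
  deg x z₁ z₂ z₃ h₁ h₂ h₃ := by
    have := h.deg x z₁ z₂ z₃
    have := huv.ne
    simp only [sup_adj, edge_adj] at h₁ h₂ h₃
    grind
  pc x z₁ z₂ h₁ h₂ hne := by
    have := h.pc x z₁ z₂
    have := huv.ne
    have := hc u v
    simp only [sup_adj, edge_adj] at h₁ h₂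
    grind
  long := h.long.sup_edge ht hf

end IsLongPathCycle

lemma edgeSet_ncard_sup_edge [Finite V] {u v : V} (hn : ¬ K.Adj u v) (h : u ≠ v) :
    (K ⊔ edge u v).edgeSet.ncard = K.edgeSet.ncard + 1 := by
  classical
  have := Fintype.ofFinite V
  have := K.card_edgeFinset_sup_edge hn h
  rwa [← Set.ncard_coe_finset, ← Set.ncard_coe_finset, coe_edgeFinset, coe_edgeFinset] at this

/-- `H` has the maximum number of edges among all `IsLongPathCycle` subgraphs. -/
def IsMaximum (G : SimpleGraph V) (c : V → V → ℕ) (t : ℕ) (H : SimpleGraph V) : Prop :=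
  IsLongPathCycle G c t H ∧ ∀ K, IsLongPathCycle G c t K → K.edgeSet.ncard ≤ H.edgeSet.ncard

/-- Deleting `ab` and `uw` and adding `pb`, `qu` and `aw` would enlarge a maximum `H`. -/
lemma IsMaximum.not_exchange [Finite V] (hH : IsMaximum G c t H) (hc : ∀ u v, c u v = c v u)
    (ht : 3 ≤ t) {p q a b u w : V} (hpw : p ≠ w) (hqa : q ≠ a) (hub : u ≠ b)
    (hpb : G.Adj p b) (hqu : G.Adj q u) (haw : G.Adj a w)
    (hab : H.Adj a b) (huw : H.Adj u w) (hpq : p ≠ q)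
    (fpb : WalkFar H (t - 1) p b) (fqb : WalkFar H (t - 1) q b)
    (fpu : WalkFar H (t - 1) p u) (fqu : WalkFar H (t - 1) q u) (faw : WalkFar H (t - 1) a w)
    (dp : ∀ z z', H.Adj p z → H.Adj p z' → z = z') (dq : ∀ z z', H.Adj q z → H.Adj q z' → z = z')
    (cp : ∀ z, H.Adj p z → c p z ≠ c p b) (cq : ∀ z, H.Adj q z → c q z ≠ c q u)
    (cb : ∀ z, z ≠ a → H.Adj b z → c b z ≠ c p b) (cu : ∀ z, z ≠ w → H.Adj u z → c u z ≠ c q u)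
    (ca : ∀ z, z ≠ b → H.Adj a z → c a z ≠ c a w) (cw : ∀ z, z ≠ u → H.Adj w z → c w z ≠ c a w) :
    False := by
  obtain ⟨r, rfl⟩ : ∃ r, t = r + 3 := ⟨t - 3, by omega⟩
  simp only [show r + 3 - 1 = r + 2 by omega] at *
  have npb := fpb.ne (by omega)
  have nqb := fqb.ne (by omega)
  have npu := fpu.ne (by omega)
  have nqu := fqu.ne (by omega)
  have naw := faw.ne (by omega)
  have apb := fpb.not_adj (by omega)
  have apu := fpu.not_adj (by omega)
  have aqu := fqu.not_adj (by omega)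
  have aaw := faw.not_adj (by omega)
  have nab := hab.ne
  have nuw := huw.ne
  have npa : p ≠ a := by rintro rfl; exact apb hab
  have nqw : q ≠ w := by rintro rfl; exact aqu huw.symm
  have nbw : b ≠ w := by rintro rfl; exact aaw hab
  have nau : a ≠ u := by rintro rfl; exact aaw huw
  set K := H.deleteEdges {s(a, b), s(u, w)} with hKdef
  have hK : K ≤ H := deleteEdges_le _
  have Kadj : ∀ x y, K.Adj x y ↔ H.Adj x y ∧ ¬ (x = a ∧ y = b ∨ x = b ∧ y = a) ∧
      ¬ (x = u ∧ y = w ∨ x = w ∧ y = u) := by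
    intro x y
    simp [K, deleteEdges_adj]
  have gK := hH.1.anti hK
  have deg := hH.1.deg
  have pc := hH.1.pc
  have sym : ∀ x y, H.Adj x y → H.Adj y x := fun _ _ h ↦ h.symm
  -- distances in `K`
  have Kab : WalkFar K (r + 2) a b := hH.1.long.walkFar hK hab (by simp [Kadj])
  have Kuw : WalkFar K (r + 2) u w := hH.1.long.walkFar hK huw (by simp [Kadj])
  have Kbw : WalkFar K (r + 1) b w := (faw.of_adj_left hab).anti hK
  have Kau : WalkFar K (r + 1) a u := (faw.of_adj_right huw.symm).anti hK
  have Kbu : WalkFar K r b u := ((faw.of_adj_left hab).of_adj_right huw.symm).anti hK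
  have Kpq : WalkFar K 1 p q := .one_of_ne hpq
  have Kpw : WalkFar K 1 p w := .one_of_ne hpw
  have Kpb := fpb.anti hK
  have Kqb := fqb.anti hK
  have Kpu := fpu.anti hK
  have Kqu := fqu.anti hK
  have Kaw := faw.anti hK
  have g₁ : IsLongPathCycle G c (r + 3) (K ⊔ edge p b) := by
    refine gK.sup_edge hc (by omega) hpb Kpb ?_ ?_ ?_ ?_ <;> grind
  have K₁qu : WalkFar (K ⊔ edge p b) (r + 2) q u :=
    Kqu.sup_edge Kpq.symm Kbu (by omega) Kqb Kpu (by omega)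
  have K₁aw : WalkFar (K ⊔ edge p b) (r + 2) a w :=
    Kaw.sup_edge .zero Kbw (by omega) Kab Kpw (by omega)
  have K₁uw : WalkFar (K ⊔ edge p b) (r + 1) u w :=
    (Kuw.mono (by omega)).sup_edge .zero Kbw (by omega) Kbu.symm Kpw (by omega)
  have K₁au : WalkFar (K ⊔ edge p b) (r + 1) a u :=
    Kau.sup_edge .zero Kbu (by omega) Kab .zero (by omega)
  have g₂ : IsLongPathCycle G c (r + 3) (K ⊔ edge p b ⊔ edge q u) := by
    refine g₁.sup_edge hc (by omega) hqu K₁qu ?_ ?_ ?_ ?_ <;>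
      simp only [sup_adj, edge_adj] <;> grind
  have K₂aw : WalkFar (K ⊔ edge p b ⊔ edge q u) (r + 2) a w :=
    K₁aw.sup_edge .zero K₁uw (by omega) K₁au .zero (by omega)
  have g₃ : IsLongPathCycle G c (r + 3) (K ⊔ edge p b ⊔ edge q u ⊔ edge a w) := by
    refine g₂.sup_edge hc (by omega) haw K₂aw ?_ ?_ ?_ ?_ <;>
      simp only [sup_adj, edge_adj] <;> grind
  have hmax := hH.2 _ g₃
  have hdel : H.edgeSet.ncard ≤ K.edgeSet.ncard + 2 := by
    rw [hKdef, edgeSet_deleteEdges]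
    have h₁ := Set.ncard_le_ncard_sdiff_add_ncard H.edgeSet {s(a, b), s(u, w)}
    have h₂ := Set.ncard_insert_le s(a, b) {s(u, w)}
    rw [Set.ncard_singleton] at h₂
    omega
  rw [edgeSet_ncard_sup_edge, edgeSet_ncard_sup_edge, edgeSet_ncard_sup_edge] at hmax
  all_goals try simp only [sup_adj, edge_adj]
  all_goals grind

/-- A vertex `b` far from an end `p` has an edge which may be deleted in favour of `pb`. -/
lemma IsMaximum.exists_removable [Finite V] (hH : IsMaximum G c t H)
    (hc : ∀ u v, c u v = c v u) (ht : 3 ≤ t) {p b : V} (hpb : G.Adj p b)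
    (fpb : WalkFar H (t - 1) p b) (dp : ∀ z z', H.Adj p z → H.Adj p z' → z = z')
    (cp : ∀ z, H.Adj p z → c p z ≠ c p b) :
    ∃ a, H.Adj b a ∧ ∀ z, z ≠ a → H.Adj b z → c b z ≠ c p b := by
  by_cases h₁ : ∃ a, H.Adj b a ∧ c b a = c p b
  · obtain ⟨a, ha, hca⟩ := h₁
    exact ⟨a, ha, fun z hz hbz ↦ hca ▸ hH.1.pc b z a hbz ha hz⟩
  · push Not at h₁
    by_cases h₂ : ∃ a, H.Adj b a
    · obtain ⟨a, ha⟩ := h₂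
      exact ⟨a, ha, fun z _ hz ↦ h₁ z hz⟩
    · push Not at h₂
      have hmax := hH.2 _ (hH.1.sup_edge hc (by omega) hpb fpb dp
        (fun z _ hz ↦ (h₂ z hz).elim) cp h₁)
      rw [edgeSet_ncard_sup_edge (fpb.not_adj (by omega)) hpb.ne] at hmax
      omega

/-- The vertices at distance exactly `k` from `v`. -/
def distLayer (H : SimpleGraph V) (v : V) (k : ℕ) : Set V :=
  {u | WalkFar H k u v ∧ ∃ p : H.Walk u v, p.length = k}

lemma distLayer_zero (v : V) : distLayer H v 0 = {v} := by
  ext u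
  refine ⟨fun ⟨_, p, hp⟩ ↦ Walk.eq_of_length_eq_zero hp, ?_⟩
  rintro rfl
  exact ⟨.zero, Walk.nil, rfl⟩

lemma exists_adj_of_mem_distLayer {v u : V} {k : ℕ} (h : u ∈ distLayer H v (k + 1)) :
    ∃ z ∈ distLayer H v k, H.Adj u z := by
  obtain ⟨hf, p, hp⟩ := h
  cases p with
  | nil => simp at hp
  | cons ha p => exact ⟨_, ⟨hf.of_adj_left ha, p, by simpa using hp⟩, ha⟩

lemma eq_of_mem_distLayer {v u : V} {k l : ℕ} (hk : u ∈ distLayer H v k)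
    (hl : u ∈ distLayer H v l) : k = l := by
  obtain ⟨hf, p, hp⟩ := hk
  obtain ⟨hf', p', hp'⟩ := hl
  have := hf p'
  have := hf' p
  omega

lemma distLayer_succ_ncard_le [Finite V]
    (deg : ∀ v z₁ z₂ z₃, H.Adj v z₁ → H.Adj v z₂ → H.Adj v z₃ → z₁ = z₂ ∨ z₁ = z₃ ∨ z₂ = z₃)
    {v : V} {d : ℕ} (hd : (H.neighborSet v).ncard ≤ d) (k : ℕ) :
    (distLayer H v (k + 1)).ncard ≤ d := by
  induction k with
  | zero =>
    refine (Set.ncard_le_ncard ?_ (Set.toFinite _)).trans hd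
    intro u hu
    obtain ⟨z, hz, ha⟩ := exists_adj_of_mem_distLayer hu
    rw [distLayer_zero] at hz
    cases hz
    exact ha.symm
  | succ k ih =>
    refine le_trans ?_ ih
    choose! g hg hga using fun u (hu : u ∈ distLayer H v (k + 1 + 1)) ↦
      exists_adj_of_mem_distLayer hu
    refine Set.ncard_le_ncard_of_injOn g hg ?_ (Set.toFinite _)
    intro u hu u' hu' he
    obtain ⟨z, hz, haz⟩ := exists_adj_of_mem_distLayer (hg u hu)
    have h₁ := hga u hu
    have h₂ := he ▸ hga u' hu'
    rcases deg (g u) z u u' haz h₁.symm h₂.symm with rfl | rfl | h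
    · have := eq_of_mem_distLayer hz hu
      omega
    · have := eq_of_mem_distLayer hz hu'
      omega
    · exact h

lemma exists_mem_distLayer_of_not_walkFar {r : ℕ} {u v : V} (h : ¬ WalkFar H r u v) :
    ∃ k < r, u ∈ distLayer H v k := by
  classical
  simp only [WalkFar, not_forall, not_le] at h
  obtain ⟨p, hp⟩ := h
  have hex : ∃ k, ∃ p : H.Walk u v, p.length = k := ⟨_, p, rfl⟩
  refine ⟨Nat.find hex, (Nat.find_min' hex ⟨p, rfl⟩).trans_lt hp, ?_, Nat.find_spec hex⟩
  exact fun p' ↦ Nat.find_min' hex ⟨p', rfl⟩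

lemma ncard_odd_near_le [Finite V]
    (deg : ∀ v z₁ z₂ z₃, H.Adj v z₁ → H.Adj v z₂ → H.Adj v z₃ → z₁ = z₂ ∨ z₁ = z₃ ∨ z₂ = z₃)
    {v : V} {d r : ℕ} (hd : (H.neighborSet v).ncard ≤ d) :
    {u | ∃ k < r, Odd k ∧ u ∈ distLayer H v k}.ncard ≤ d * (r / 2) := by
  have hsub : {u | ∃ k < r, Odd k ∧ u ∈ distLayer H v k} ⊆
      ⋃ j ∈ Finset.range (r / 2), distLayer H v (2 * j + 1) := by
    rintro u ⟨k, hk, ⟨j, rfl⟩, hu⟩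
    simp only [Set.mem_iUnion]
    exact ⟨j, Finset.mem_range.2 (by omega), hu⟩
  calc _ ≤ _ := Set.ncard_le_ncard hsub (Set.toFinite _)
    _ ≤ ∑ j ∈ Finset.range (r / 2), (distLayer H v (2 * j + 1)).ncard :=
      Finset.set_ncard_biUnion_le _ _
    _ ≤ ∑ j ∈ Finset.range (r / 2), d :=
      Finset.sum_le_sum fun j _ ↦ distLayer_succ_ncard_le deg hd _
    _ = d * (r / 2) := by simp [mul_comm]

lemma ncard_even_near_le [Finite V]
    (deg : ∀ v z₁ z₂ z₃, H.Adj v z₁ → H.Adj v z₂ → H.Adj v z₃ → z₁ = z₂ ∨ z₁ = z₃ ∨ z₂ = z₃)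
    {v : V} {r : ℕ} (hd : (H.neighborSet v).ncard ≤ 1) :
    {u | ∃ k < r, Even k ∧ u ∈ distLayer H v k}.ncard ≤ (r + 1) / 2 := by
  have hsub : {u | ∃ k < r, Even k ∧ u ∈ distLayer H v k} ⊆
      ⋃ j ∈ Finset.range ((r + 1) / 2), distLayer H v (2 * j) := by
    rintro u ⟨k, hk, ⟨j, rfl⟩, hu⟩
    simp only [Set.mem_iUnion]
    exact ⟨j, Finset.mem_range.2 (by omega), by rwa [two_mul]⟩
  calc _ ≤ _ := Set.ncard_le_ncard hsub (Set.toFinite _)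
    _ ≤ ∑ j ∈ Finset.range ((r + 1) / 2), (distLayer H v (2 * j)).ncard :=
      Finset.set_ncard_biUnion_le _ _
    _ ≤ ∑ j ∈ Finset.range ((r + 1) / 2), 1 := Finset.sum_le_sum fun j _ ↦ by
      cases j with
      | zero => simp [distLayer_zero]
      | succ j => exact distLayer_succ_ncard_le deg hd (2 * j + 1)
    _ = (r + 1) / 2 := by simp

end LinearForests

section Counting

variable {V : Type*} [DecidableEq V]

lemma card_fiber_sums {A N : Finset V} {f : V → V} (hf : ∀ b ∈ N, f b ∈ A)
    (hfib : ∀ a ∈ A, (N.filter (f · = a)).card ≤ 2) :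
    N.card ≤ (A.filter fun a ↦ (N.filter (f · = a)).card = 1).card +
      2 * (A.filter fun a ↦ (N.filter (f · = a)).card = 2).card := by
  rw [Finset.card_eq_sum_card_fiberwise hf, Finset.card_filter, Finset.card_filter,
    Finset.mul_sum, ← Finset.sum_add_distrib]
  refine Finset.sum_le_sum fun a ha ↦ ?_
  have := hfib a ha
  interval_cases h : (N.filter (f · = a)).card <;> simp

lemma sum_card_add_sum_card_le {S T : Finset V} {R : V → Finset V}
    (hR : ∀ a ∈ S, ∀ w ∈ T, w ∈ R a → a ∉ R w) :
    ∑ a ∈ S, (R a ∩ T).card + ∑ w ∈ T, (R w ∩ S).card ≤ S.card * T.card := by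
  have h₁ : ∑ a ∈ S, (R a ∩ T).card = ((S ×ˢ T).filter fun x ↦ x.2 ∈ R x.1).card := by
    rw [Finset.card_filter, Finset.sum_product]
    refine Finset.sum_congr rfl fun a _ ↦ ?_
    rw [← Finset.card_filter, Finset.inter_comm]
    exact congrArg Finset.card Finset.filter_mem_eq_inter.symm
  have h₂ : ∑ w ∈ T, (R w ∩ S).card = ((S ×ˢ T).filter fun x ↦ x.1 ∈ R x.2).card := by
    rw [Finset.card_filter, Finset.sum_product_right]
    refine Finset.sum_congr rfl fun a _ ↦ ?_
    rw [← Finset.card_filter, Finset.inter_comm]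
    exact congrArg Finset.card Finset.filter_mem_eq_inter.symm
  rw [h₁, h₂, ← Finset.card_union_of_disjoint, ← Finset.card_product]
  · exact Finset.card_le_card (Finset.union_subset (Finset.filter_subset _ _)
      (Finset.filter_subset _ _))
  · rw [Finset.disjoint_filter]
    intro x hx hx₁
    rw [Finset.mem_product] at hx
    exact hR _ hx.1 _ hx.2 hx₁

/-- The double count behind the bound `2n/3`. -/
lemma double_count {n D : ℕ} {A B N M : Finset V} {f g : V → V} {R : V → Finset V}
    (hA : A.card ≤ n) (hB : B.card ≤ n) (hD : 2 * n < 3 * D)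
    (hf : ∀ b ∈ N, f b ∈ A) (hg : ∀ u ∈ M, g u ∈ B)
    (hffib : ∀ a ∈ A, (N.filter (f · = a)).card ≤ 2)
    (hgfib : ∀ w ∈ B, (M.filter (g · = w)).card ≤ 2)
    (hN : D ≤ N.card) (hM : D ≤ M.card)
    (hRA : ∀ a ∈ A, R a ⊆ B ∧ D ≤ (R a).card) (hRB : ∀ w ∈ B, R w ⊆ A ∧ D ≤ (R w).card)
    (hAB : ∀ b ∈ N, ∀ w ∈ B, w ∈ R (f b) → (M.filter (g · = w)).card ≠ 2)
    (hBA : ∀ u ∈ M, ∀ a ∈ A, a ∈ R (g u) → (N.filter (f · = a)).card ≠ 2)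
    (hR : ∀ b ∈ N, ∀ u ∈ M, g u ∈ R (f b) → f b ∉ R (g u)) : False := by
  have hs := card_fiber_sums hf hffib
  have ht := card_fiber_sums hg hgfib
  have memf : ∀ a, 0 < (N.filter (f · = a)).card → ∃ b ∈ N, f b = a := by
    intro a ha
    obtain ⟨b, hb⟩ := Finset.card_pos.1 ha
    exact ⟨b, (Finset.mem_filter.1 hb).1, (Finset.mem_filter.1 hb).2⟩
  have memg : ∀ a, 0 < (M.filter (g · = a)).card → ∃ b ∈ M, g b = a := by
    intro a ha
    obtain ⟨b, hb⟩ := Finset.card_pos.1 ha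
    exact ⟨b, (Finset.mem_filter.1 hb).1, (Finset.mem_filter.1 hb).2⟩
  set S₁ := A.filter fun a ↦ (N.filter (f · = a)).card = 1 with hS₁
  set S₂ := A.filter fun a ↦ (N.filter (f · = a)).card = 2 with hS₂
  set T₁ := B.filter fun a ↦ (M.filter (g · = a)).card = 1 with hT₁
  set T₂ := B.filter fun a ↦ (M.filter (g · = a)).card = 2 with hT₂
  have key : ∀ {X Q P₁ P₂ : Finset V}, Q.card ≤ n → X ⊆ Q → P₁ ⊆ Q → P₂ ⊆ Q → D ≤ X.card →
      Disjoint P₁ P₂ → Disjoint X P₂ → D + P₁.card + P₂.card ≤ (X ∩ P₁).card + n := by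
    intro X Q P₁ P₂ hQ hX h₁ h₂ hDX h₁₂ hX₂
    have e₁ := Finset.card_union_add_card_inter X P₁
    have e₂ : Disjoint (X ∪ P₁) P₂ := Finset.disjoint_union_left.2 ⟨hX₂, h₁₂⟩
    have e₃ := Finset.card_union_of_disjoint e₂
    have e₄ := Finset.card_le_card (Finset.union_subset (Finset.union_subset hX h₁) h₂)
    omega
  have hSd : Disjoint S₁ S₂ := by
    rw [Finset.disjoint_filter]; intro _ _ h; omega
  have hTd : Disjoint T₁ T₂ := by
    rw [Finset.disjoint_filter]; intro _ _ h; omega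
  have cA : ∀ b ∈ N, D + T₁.card + T₂.card ≤ (R (f b) ∩ T₁).card + n := by
    intro b hb
    obtain ⟨h₁, h₂⟩ := hRA _ (hf b hb)
    refine key hB h₁ (Finset.filter_subset _ _) (Finset.filter_subset _ _) h₂ hTd ?_
    rw [Finset.disjoint_left]
    intro w hw hw₂
    rw [hT₂, Finset.mem_filter] at hw₂
    exact hAB b hb w hw₂.1 hw hw₂.2
  have cB : ∀ u ∈ M, D + S₁.card + S₂.card ≤ (R (g u) ∩ S₁).card + n := by
    intro b hb
    obtain ⟨h₁, h₂⟩ := hRB _ (hg b hb)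
    refine key hA h₁ (Finset.filter_subset _ _) (Finset.filter_subset _ _) h₂ hSd ?_
    rw [Finset.disjoint_left]
    intro w hw hw₂
    rw [hS₂, Finset.mem_filter] at hw₂
    exact hBA b hb w hw₂.1 hw hw₂.2
  have hsum : ∑ a ∈ S₁, (R a ∩ T₁).card + ∑ w ∈ T₁, (R w ∩ S₁).card ≤ S₁.card * T₁.card := by
    refine sum_card_add_sum_card_le ?_
    intro a ha w hw
    rw [hS₁, Finset.mem_filter] at ha
    rw [hT₁, Finset.mem_filter] at hw
    obtain ⟨b, hb, rfl⟩ := memf a (by omega)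
    obtain ⟨u, hu, rfl⟩ := memg w (by omega)
    exact hR b hb u hu
  have sA : S₁.card * (D + T₁.card + T₂.card) ≤ ∑ a ∈ S₁, (R a ∩ T₁).card + S₁.card * n := by
    rw [← smul_eq_mul, ← smul_eq_mul S₁.card n, ← Finset.sum_const, ← Finset.sum_const,
      ← Finset.sum_add_distrib]
    refine Finset.sum_le_sum fun a ha ↦ ?_
    rw [hS₁, Finset.mem_filter] at ha
    obtain ⟨b, hb, rfl⟩ := memf a (by omega)
    exact cA b hb
  have sB : T₁.card * (D + S₁.card + S₂.card) ≤ ∑ w ∈ T₁, (R w ∩ S₁).card + T₁.card * n := by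
    rw [← smul_eq_mul, ← smul_eq_mul T₁.card n, ← Finset.sum_const, ← Finset.sum_const,
      ← Finset.sum_add_distrib]
    refine Finset.sum_le_sum fun a ha ↦ ?_
    rw [hT₁, Finset.mem_filter] at ha
    obtain ⟨b, hb, rfl⟩ := memg a (by omega)
    exact cB b hb
  generalize ∑ a ∈ S₁, (R a ∩ T₁).card = σA at *
  generalize ∑ w ∈ T₁, (R w ∩ S₁).card = σB at *
  have hzero : S₁.card = 0 ∧ T₁.card = 0 := by
    have h₁ : S₁.card * D ≤ S₁.card * (T₁.card + 2 * T₂.card) :=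
      Nat.mul_le_mul_left _ (hM.trans ht)
    have h₂ : T₁.card * D ≤ T₁.card * (S₁.card + 2 * S₂.card) :=
      Nat.mul_le_mul_left _ (hN.trans hs)
    have h₃ : S₁.card * (2 * n + 1) ≤ S₁.card * (3 * D) := Nat.mul_le_mul_left _ hD
    have h₄ : T₁.card * (2 * n + 1) ≤ T₁.card * (3 * D) := Nat.mul_le_mul_left _ hD
    constructor <;> nlinarith
  obtain ⟨b, hb⟩ := Finset.card_pos.1 (by omega : 0 < N.card)
  have := cA b hb
  have h₀ : (R (f b) ∩ T₁).card ≤ T₁.card := Finset.card_le_card Finset.inter_subset_right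
  omega

end Counting

section Bipartite

variable {n t : ℕ} {c : V2 n → V2 n → ℕ} {H : SimpleGraph (V2 n)}

lemma KBB_adj_iff {u v w : V2 n} (h : (KBB n).Adj u v) :
    (KBB n).Adj u w ↔ ¬ (KBB n).Adj v w := by
  rcases u with u | u <;> rcases v with v | v <;> rcases w with w | w <;> simp_all [KBB]

lemma odd_length_iff (hH : H ≤ KBB n) {u v : V2 n} (p : H.Walk u v) :
    Odd p.length ↔ (KBB n).Adj u v := by
  induction p with
  | nil => simp
  | cons h p ih => rw [Walk.length_cons, Nat.odd_add_one, ih, KBB_adj_iff (hH h)]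

open Classical in
lemma card_filter_KBB_adj (v : V2 n) : (Finset.univ.filter ((KBB n).Adj v)).card ≤ n := by
  rcases v with v | v
  · refine (Finset.card_le_card (t := Finset.univ.image Sum.inr) ?_).trans
      (Finset.card_image_le.trans (by simp))
    intro w hw
    have := (Finset.mem_filter.1 hw).2
    rcases w with w | w <;> simp_all [KBB]
  · refine (Finset.card_le_card (t := Finset.univ.image Sum.inl) ?_).trans
      (Finset.card_image_le.trans (by simp))
    intro w hw
    have := (Finset.mem_filter.1 hw).2
    rcases w with w | w <;> simp_all [KBB]

open Classical in
/-- The neighbors of `v` in `K_{n,n}` whose color at `v` does not occur on `B`. -/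
noncomputable def newColorNbrs (c : V2 n → V2 n → ℕ) (v : V2 n) (B : Finset (V2 n)) :
    Finset (V2 n) :=
  Finset.univ.filter fun w ↦ (KBB n).Adj v w ∧ ∀ z ∈ B, c v z ≠ c v w

lemma mem_newColorNbrs {v w : V2 n} {B : Finset (V2 n)} :
    w ∈ newColorNbrs c v B ↔ (KBB n).Adj v w ∧ ∀ z ∈ B, c v z ≠ c v w := by
  simp [newColorNbrs]

lemma colorDeg_le (v : V2 n) (B : Finset (V2 n)) :
    colorDeg n c v ≤ (newColorNbrs c v B).card + B.card := by
  classical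
  have key : ∀ I : Finset ℕ, (∀ k ∈ I, ∃ w, (KBB n).Adj v w ∧ c v w = k) →
      I.card ≤ (newColorNbrs c v B).card + B.card := by
    intro I hI
    have hsub : I ⊆ (newColorNbrs c v B).image (c v) ∪ B.image (c v) := by
      intro k hk
      obtain ⟨w, hw, rfl⟩ := hI k hk
      by_cases hB : ∃ z ∈ B, c v z = c v w
      · obtain ⟨z, hz, hzw⟩ := hB
        exact Finset.mem_union_right _ (Finset.mem_image.2 ⟨z, hz, hzw⟩)
      · push Not at hB
        exact Finset.mem_union_left _ (Finset.mem_image_of_mem _ (mem_newColorNbrs.2 ⟨hw, hB⟩))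
    exact (Finset.card_le_card hsub).trans ((Finset.card_union_le _ _).trans
      (Nat.add_le_add Finset.card_image_le Finset.card_image_le))
  rcases v with x | y
  · refine key _ fun k hk ↦ ?_
    obtain ⟨j, -, rfl⟩ := Finset.mem_image.1 hk
    exact ⟨_, by simp [KBB], rfl⟩
  · refine key _ fun k hk ↦ ?_
    obtain ⟨j, -, rfl⟩ := Finset.mem_image.1 hk
    exact ⟨_, by simp [KBB], rfl⟩

open Classical in
/-- The vertices opposite to `p` which are joined to `v` by a walk of `H` with fewer than `r`
edges. -/
noncomputable def nearSet (H : SimpleGraph (V2 n)) (r : ℕ) (p v : V2 n) : Finset (V2 n) :=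
  Finset.univ.filter fun u ↦ (KBB n).Adj p u ∧ ¬ WalkFar H r v u

lemma mem_nearSet {r : ℕ} {p v u : V2 n} :
    u ∈ nearSet H r p v ↔ (KBB n).Adj p u ∧ ¬ WalkFar H r v u := by
  simp [nearSet]

lemma mem_nearSet_of_adj {r : ℕ} {v u : V2 n} (hH : H ≤ KBB n) (hr : 2 ≤ r) (h : H.Adj v u) :
    u ∈ nearSet H r v v :=
  mem_nearSet.2 ⟨hH h, fun hf ↦ hf.not_adj hr h⟩

lemma walkFar_of_mem_newColorNbrs {r : ℕ} {p v u : V2 n} {B : Finset (V2 n)}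
    (hB : nearSet H r p v ⊆ B) (h : u ∈ newColorNbrs c p B) : WalkFar H r v u := by
  rw [mem_newColorNbrs] at h
  by_contra hf
  exact h.2 u (hB (mem_nearSet.2 ⟨h.1, hf⟩)) rfl

lemma card_nearSet_self_le {r d : ℕ} {v : V2 n} (hH : IsLongPathCycle (KBB n) c t H)
    (hd : (H.neighborSet v).ncard ≤ d) : (nearSet H r v v).card ≤ d * (r / 2) := by
  rw [← Set.ncard_coe_finset]
  refine (Set.ncard_le_ncard ?_ (Set.toFinite _)).trans (ncard_odd_near_le hH.deg hd)
  intro u hu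
  obtain ⟨hu, hf⟩ := mem_nearSet.1 (Finset.mem_coe.1 hu)
  obtain ⟨k, hk, hmem⟩ := exists_mem_distLayer_of_not_walkFar (fun h ↦ hf (WalkFar.symm h))
  obtain ⟨p, rfl⟩ := hmem.2
  exact ⟨_, hk, (odd_length_iff hH.le p).2 hu.symm, hmem⟩

lemma card_nearSet_opposite_le {r : ℕ} {p q : V2 n} (hH : IsLongPathCycle (KBB n) c t H)
    (hpq : (KBB n).Adj p q) (hd : (H.neighborSet q).ncard ≤ 1) :
    (nearSet H r p q).card ≤ (r + 1) / 2 := by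
  rw [← Set.ncard_coe_finset]
  refine (Set.ncard_le_ncard ?_ (Set.toFinite _)).trans (ncard_even_near_le hH.deg hd)
  intro u hu
  obtain ⟨hu, hf⟩ := mem_nearSet.1 (Finset.mem_coe.1 hu)
  obtain ⟨k, hk, hmem⟩ := exists_mem_distLayer_of_not_walkFar (fun h ↦ hf (WalkFar.symm h))
  obtain ⟨w, rfl⟩ := hmem.2
  refine ⟨_, hk, ?_, hmem⟩
  rw [← Nat.not_odd_iff_even, odd_length_iff hH.le w, (KBB n).adj_comm, ← KBB_adj_iff hpq]
  exact hu

lemma neighborSet_ncard_le_two (hH : IsLongPathCycle (KBB n) c t H) (v : V2 n) :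
    (H.neighborSet v).ncard ≤ 2 := by
  by_contra! h
  obtain ⟨z₁, h₁, z₂, h₂, z₃, h₃, h₁₂, h₁₃, h₂₃⟩ := (Set.two_lt_ncard (Set.toFinite _)).1 h
  rcases hH.deg v z₁ z₂ z₃ h₁ h₂ h₃ with h | h | h <;> contradiction

lemma IsMaximum.exists_rotations (hH : IsMaximum (KBB n) c t H) (hc : ∀ u v, c u v = c v u)
    (ht : 3 ≤ t) {D : ℕ} (hD : ∀ v, D + (t - 1) ≤ colorDeg n c v) {p q : V2 n}
    (hpq : (KBB n).Adj p q) (hp : (H.neighborSet p).ncard ≤ 1)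
    (hq : (H.neighborSet q).ncard ≤ 1) :
    ∃ (N : Finset (V2 n)) (f : V2 n → V2 n), D ≤ N.card ∧ ∀ b ∈ N, (KBB n).Adj p b ∧
      WalkFar H (t - 1) p b ∧ WalkFar H (t - 1) q b ∧ (∀ z, H.Adj p z → c p z ≠ c p b) ∧
      H.Adj b (f b) ∧ ∀ z, z ≠ f b → H.Adj b z → c b z ≠ c p b := by
  classical
  set B := nearSet H (t - 1) p p ∪ nearSet H (t - 1) p q
  have hB : B.card ≤ t - 1 := by
    have h₁ := Finset.card_union_le (nearSet H (t - 1) p p) (nearSet H (t - 1) p q)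
    have h₂ := card_nearSet_self_le (r := t - 1) hH.1 hp
    have h₃ := card_nearSet_opposite_le (r := t - 1) hH.1 hpq hq
    change B.card ≤ _ at h₁
    omega
  have dp : ∀ z z', H.Adj p z → H.Adj p z' → z = z' := fun z z' hz hz' ↦
    (Set.ncard_le_one (Set.toFinite _)).1 hp z hz z' hz'
  have base : ∀ b ∈ newColorNbrs c p B, (KBB n).Adj p b ∧ WalkFar H (t - 1) p b ∧
      WalkFar H (t - 1) q b ∧ ∀ z, H.Adj p z → c p z ≠ c p b := fun b hb ↦
    ⟨(mem_newColorNbrs.1 hb).1, walkFar_of_mem_newColorNbrs Finset.subset_union_left hb,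
      walkFar_of_mem_newColorNbrs Finset.subset_union_right hb, fun z hz ↦
      (mem_newColorNbrs.1 hb).2 z
        (Finset.mem_union_left _ (mem_nearSet_of_adj hH.1.le (by omega) hz))⟩
  choose! f hf using fun b (hb : b ∈ newColorNbrs c p B) ↦
    hH.exists_removable hc ht (base b hb).1 (base b hb).2.1 dp (base b hb).2.2.2
  refine ⟨newColorNbrs c p B, f, ?_, fun b hb ↦ ?_⟩
  · have := hD p
    have := colorDeg_le (c := c) p B
    omega
  · obtain ⟨h₁, h₂, h₃, h₄⟩ := base b hb
    exact ⟨h₁, h₂, h₃, h₄, hf b hb⟩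

lemma IsMaximum.not_opposite_ends (hH : IsMaximum (KBB n) c t H) (hc : ∀ u v, c u v = c v u)
    (ht : 3 ≤ t) {D : ℕ} (hD : ∀ v, D + (t - 1) ≤ colorDeg n c v) (hnD : 2 * n < 3 * D)
    {p q : V2 n} (hpq : (KBB n).Adj p q) (hp : (H.neighborSet p).ncard ≤ 1)
    (hq : (H.neighborSet q).ncard ≤ 1) : False := by
  classical
  obtain ⟨N, f, hN, hf⟩ := hH.exists_rotations hc ht hD hpq hp hq
  obtain ⟨M, g, hM, hg⟩ := hH.exists_rotations hc ht hD hpq.symm hq hp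
  have dp : ∀ z z', H.Adj p z → H.Adj p z' → z = z' := fun z z' hz hz' ↦
    (Set.ncard_le_one (Set.toFinite _)).1 hp z hz z' hz'
  have dq : ∀ z z', H.Adj q z → H.Adj q z' → z = z' := fun z z' hz hz' ↦
    (Set.ncard_le_one (Set.toFinite _)).1 hq z hz z' hz'
  set R : V2 n → Finset (V2 n) := fun v ↦ newColorNbrs c v (nearSet H (t - 1) v v) with hRdef
  have hRD : ∀ v, D ≤ (R v).card := by
    intro v
    have h₁ := hD v
    have h₂ := colorDeg_le (c := c) v (nearSet H (t - 1) v v)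
    have h₃ := card_nearSet_self_le (r := t - 1) hH.1 (neighborSet_ncard_le_two hH.1 v)
    simp only [hRdef]
    omega
  have hRfar : ∀ {a w}, w ∈ R a → WalkFar H (t - 1) a w := fun h ↦
    walkFar_of_mem_newColorNbrs subset_rfl h
  have hRcol : ∀ {a w}, w ∈ R a → ∀ z, H.Adj a z → c a z ≠ c a w := fun h z hz ↦
    (mem_newColorNbrs.1 h).2 z (mem_nearSet_of_adj hH.1.le (by omega) hz)
  have hRadj : ∀ {a w}, w ∈ R a → (KBB n).Adj a w := fun h ↦ (mem_newColorNbrs.1 h).1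
  have sideA : ∀ {a b}, (KBB n).Adj p b → H.Adj b a → (KBB n).Adj q a := by
    intro a b hb ha
    rw [KBB_adj_iff hpq.symm, KBB_adj_iff hb, not_not]
    exact hH.1.le ha
  have sideB : ∀ {a b}, (KBB n).Adj q b → H.Adj b a → (KBB n).Adj p a := by
    intro a b hb ha
    rw [KBB_adj_iff hpq, KBB_adj_iff hb, not_not]
    exact hH.1.le ha
  have exch : ∀ b ∈ N, ∀ u ∈ M, (KBB n).Adj (f b) (g u) → WalkFar H (t - 1) (f b) (g u) →
      (∀ z, z ≠ b → H.Adj (f b) z → c (f b) z ≠ c (f b) (g u)) →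
      (∀ z, z ≠ u → H.Adj (g u) z → c (g u) z ≠ c (f b) (g u)) → False := by
    intro b hb u hu haw faw ca cw
    obtain ⟨hpb, fpb, fqb, cp, hba, cb⟩ := hf b hb
    obtain ⟨hqu, fqu, fpu, cq, huw, cu⟩ := hg u hu
    have hpw := sideB hqu huw
    have hqa := sideA hpb hba
    have hub : u ≠ b := by
      rintro rfl
      exact (KBB_adj_iff hpq).1 hpb hqu
    exact hH.not_exchange hc ht hpw.ne hqa.ne hub hpb hqu haw hba.symm huw hpq.ne fpb fqb fpu fqu
      faw dp dq cp cq cb cu ca cw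
  have fib : ∀ (N : Finset (V2 n)) (f : V2 n → V2 n), (∀ b ∈ N, H.Adj b (f b)) → ∀ a,
      ((N.filter (f · = a)).card ≤ 2) := by
    intro N f hf a
    rw [← Set.ncard_coe_finset]
    refine (Set.ncard_le_ncard ?_ (Set.toFinite _)).trans (neighborSet_ncard_le_two hH.1 a)
    intro b hb
    obtain ⟨hbN, rfl⟩ := Finset.mem_filter.1 (Finset.mem_coe.1 hb)
    exact (hf b hbN).symm
  have two : ∀ (N : Finset (V2 n)) (f : V2 n → V2 n), (∀ b ∈ N, H.Adj b (f b)) → ∀ a k,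
      (N.filter (f · = a)).card = 2 →
      ∃ b ∈ N, f b = a ∧ ∀ z, z ≠ b → H.Adj a z → c a z ≠ k := by
    intro N f hf a k h
    obtain ⟨b₁, b₂, hne, heq⟩ := Finset.card_eq_two.1 h
    have m₁ : b₁ ∈ N.filter (f · = a) := by rw [heq]; simp
    have m₂ : b₂ ∈ N.filter (f · = a) := by rw [heq]; simp
    obtain ⟨h₂, h₂₁⟩ := Finset.mem_filter.1 m₂
    obtain ⟨h₁, rfl⟩ := Finset.mem_filter.1 m₁
    have a₁ := (hf b₁ h₁).symm
    have a₂ := (hf b₂ h₂).symm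
    rw [h₂₁] at a₂
    have hdeg := fun z hz ↦ hH.1.deg (f b₁) z b₁ b₂ hz a₁ a₂
    have hpc := hH.1.pc (f b₁) b₁ b₂ a₁ a₂ hne
    by_cases hk : c (f b₁) b₂ = k
    · refine ⟨b₂, h₂, h₂₁, fun z hz ha ↦ ?_⟩
      rcases hdeg z ha with rfl | rfl | h
      · exact hk ▸ hpc
      · exact absurd rfl hz
      · exact absurd h hne
    · refine ⟨b₁, h₁, rfl, fun z hz ha ↦ ?_⟩
      rcases hdeg z ha with rfl | rfl | h
      · exact absurd rfl hz
      · exact hk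
      · exact absurd h hne
  have hRsub : ∀ {x y a}, (KBB n).Adj x y → (KBB n).Adj y a →
      R a ⊆ Finset.univ.filter ((KBB n).Adj x) := by
    intro x y a hxy ha w hw
    have := hRadj hw
    rw [Finset.mem_filter, KBB_adj_iff hxy, KBB_adj_iff ha, not_not]
    exact ⟨Finset.mem_univ _, this⟩
  refine double_count (n := n) (D := D) (A := Finset.univ.filter ((KBB n).Adj q))
    (B := Finset.univ.filter ((KBB n).Adj p)) (N := N) (M := M) (f := f) (g := g) (R := R)
    (card_filter_KBB_adj q) (card_filter_KBB_adj p) hnD ?_ ?_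
    (fun a _ ↦ fib N f (fun b hb ↦ (hf b hb).2.2.2.2.1) a)
    (fun a _ ↦ fib M g (fun b hb ↦ (hg b hb).2.2.2.2.1) a) hN hM ?_ ?_ ?_ ?_ ?_
  · intro b hb
    obtain ⟨hpb, -, -, -, hba, -⟩ := hf b hb
    exact Finset.mem_filter.2 ⟨Finset.mem_univ _, sideA hpb hba⟩
  · intro b hb
    obtain ⟨hpb, -, -, -, hba, -⟩ := hg b hb
    exact Finset.mem_filter.2 ⟨Finset.mem_univ _, sideB hpb hba⟩
  · exact fun a ha ↦ ⟨hRsub hpq (Finset.mem_filter.1 ha).2, hRD a⟩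
  · exact fun a ha ↦ ⟨hRsub hpq.symm (Finset.mem_filter.1 ha).2, hRD a⟩
  · intro b hb w _ hwR hcard
    obtain ⟨u, hu, rfl, hk⟩ := two M g (fun b hb ↦ (hg b hb).2.2.2.2.1) w (c (f b) w) hcard
    exact exch b hb u hu (hRadj hwR) (hRfar hwR) (fun z _ hz ↦ hRcol hwR z hz) hk
  · intro u hu a _ haR hcard
    obtain ⟨b, hb, rfl, hk⟩ := two N f (fun b hb ↦ (hf b hb).2.2.2.2.1) a (c a (g u)) hcard
    exact exch b hb u hu (hRadj haR).symm (hRfar haR).symm hk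
      (fun z _ hz ↦ hc (g u) (f b) ▸ hRcol haR z hz)
  · intro b hb u hu hw ha
    exact exch b hb u hu (hRadj hw) (hRfar hw) (fun z _ hz ↦ hRcol hw z hz)
      (fun z _ hz ↦ hc (g u) (f b) ▸ hRcol ha z hz)

lemma exists_isMaximum (G : SimpleGraph (V2 n)) (c : V2 n → V2 n → ℕ) (t : ℕ) :
    ∃ H, IsMaximum G c t H := by
  obtain ⟨H, hH, hmax⟩ := Set.exists_max_image {H | IsLongPathCycle G c t H}
    (fun H ↦ H.edgeSet.ncard) (Set.toFinite _) ⟨⊥, bot_le, by simp, by simp, by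
      intro v p hp
      cases p with
      | nil => simp at hp
      | cons h _ => simp at h⟩
  exact ⟨H, hH, hmax⟩

lemma exists_opposite_ends (hH : IsLongPathCycle (KBB n) c t H) {v : V2 n}
    (hv : (H.neighborSet v).ncard ≠ 2) : ∃ p q, (KBB n).Adj p q ∧
      (H.neighborSet p).ncard ≤ 1 ∧ (H.neighborSet q).ncard ≤ 1 := by
  classical
  have hsum : ∑ i, (H.neighborSet (Sum.inl i)).ncard = ∑ j, (H.neighborSet (Sum.inr j)).ncard := by
    have hbip : H.IsBipartiteWith
        (Finset.univ.map Function.Embedding.inl : Finset (V2 n))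
        (Finset.univ.map Function.Embedding.inr : Finset (V2 n)) := by
      refine ⟨by simp [Set.disjoint_left], ?_⟩
      intro x y hxy
      have := hH.le hxy
      rcases x with x | x <;> rcases y with y | y <;> simp_all [KBB]
    have := isBipartiteWith_sum_degrees_eq hbip
    simp only [Finset.sum_map, ← card_neighborSet_eq_degree, ← Nat.card_eq_fintype_card] at this
    exact this
  have hle := neighborSet_ncard_le_two hH
  have hlt : (H.neighborSet v).ncard < 2 := lt_of_le_of_ne (hle v) hv
  have deficient : ∀ d : Fin n → ℕ, ∑ i, d i < 2 * n → ∃ i, d i ≤ 1 := by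
    intro d hd
    by_contra! h
    have := Finset.sum_le_sum (s := Finset.univ) (f := fun _ ↦ 2) (g := d) fun i _ ↦ h i
    simp at this
    omega
  have lt_of : ∀ (d : Fin n → ℕ) (i : Fin n), (∀ i, d i ≤ 2) → d i < 2 → ∑ i, d i < 2 * n := by
    intro d i hd hi
    have := Finset.sum_lt_sum (fun i (_ : i ∈ Finset.univ) ↦ hd i) ⟨i, Finset.mem_univ _, hi⟩
    simp at this
    omega
  have hl : ∑ i, (H.neighborSet (Sum.inl i)).ncard < 2 * n := by
    rcases v with i | j
    · exact lt_of _ i (fun i ↦ hle _) hlt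
    · rw [hsum]
      exact lt_of _ j (fun i ↦ hle _) hlt
  obtain ⟨i, hi⟩ := deficient _ hl
  obtain ⟨j, hj⟩ := deficient _ (hsum ▸ hl)
  exact ⟨Sum.inl i, Sum.inr j, by simp [KBB], hi, hj⟩

end Bipartite

/-- Theorem 1.4.  Let `t ≥ 3`.  Every edge-colored `K_{n,n}` with
`δ^c ≥ 2n/3 + t` contains a PC 2-factor all of whose cycles have length at least `t`. -/
theorem pc_two_factor_with_long_cycles (n t : ℕ) (ht : 3 ≤ t)
    (c : V2 n → V2 n → ℕ) (hsym : ∀ u v, c u v = c v u)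
    (hdeg : ∀ v, (2 * n : ℝ) / 3 + t ≤ (colorDeg n c v : ℝ)) :
    ∃ H : SimpleGraph (V2 n), IsPC2Factor n c H ∧ CyclesAtLeast H t := by
  obtain ⟨H, hH⟩ := exists_isMaximum (KBB n) c t
  refine ⟨H, ⟨hH.1.le, ?_, fun u v w ↦ hH.1.pc u v w⟩, hH.1.long⟩
  intro v
  by_contra hv
  obtain ⟨p, q, hpq, hp, hq⟩ := exists_opposite_ends hH.1 hv
  refine hH.not_opposite_ends hsym ht (D := 2 * n / 3 + 1) (fun v ↦ ?_) (by omega) hpq hp hq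
  have h : 2 * n + 3 * t ≤ 3 * colorDeg n c v := by
    have := hdeg v
    have : (2 * n + 3 * t : ℝ) ≤ 3 * colorDeg n c v := by linarith
    exact_mod_cast this
  omega
end

section
/- Every edge-colored complete balanced bipartite graph K^c_{n,n} with minimum color degree δ^c(K^c_{n,n}) ≥ 2n/3 + 3 contains a properly colored 2-factor. -/
open SimpleGraph

section TwoMatching

theorem lt_mul_add_of_mem_Icc {e p q : ℕ} (hp : e + 4 ≤ p) (hp' : p ≤ 2 * e + 7)
    (hq : e + 4 ≤ q) (hq' : q ≤ 2 * e + 7) :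
    2 * p + 2 * e * p + 2 * e * q < p * q + 2 * e * (2 * e + 7) := by
  obtain ⟨a, ha⟩ := Nat.exists_eq_add_of_le hp'
  obtain ⟨b, hb⟩ := Nat.exists_eq_add_of_le hq'
  have hae : a ≤ e + 3 := by omega
  have hbe : b ≤ e + 3 := by omega
  zify at *
  rw [eq_sub_of_add_eq ha.symm, eq_sub_of_add_eq hb.symm]
  rcases le_total (a : ℤ) 7 with h | h <;> rcases le_total (b : ℤ) 5 with h' | h' <;> nlinarith

variable {α β γ : Type*}

/-- At most two edges at a vertex, with distinct colors; `S` is the set of neighbors and `g`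
gives the colors. -/
def ProperPair (g : α → γ) (S : Finset α) : Prop :=
  S.card ≤ 2 ∧ Set.InjOn g S

theorem ProperPair.mono {g : α → γ} {S T : Finset α} (hT : ProperPair g T) (h : S ⊆ T) :
    ProperPair g S :=
  ⟨(Finset.card_le_card h).trans hT.1, hT.2.mono (by exact_mod_cast h)⟩

variable [DecidableEq α] [DecidableEq β] [DecidableEq γ]

theorem properPair_insert {g : α → γ} {S : Finset α} {a : α} (hS : S.card ≤ 1)
    (ha : g a ∉ S.image g) : ProperPair g (insert a S) := by
  refine ⟨(Finset.card_insert_le _ _).trans (by omega), ?_⟩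
  have hS' := Finset.card_le_one.1 hS
  intro i hi j hj hij
  simp only [Finset.coe_insert, Set.mem_insert_iff, Finset.mem_coe] at hi hj
  simp only [Finset.mem_image, not_exists, not_and] at ha
  grind

theorem ProperPair.exchange {g : α → γ} {S : Finset α} (hS : ProperPair g S) {a b : α}
    (hb : b ∈ S) (ha : g a ∉ (S.erase b).image g) :
    ProperPair g (insert a (S.erase b)) :=
  properPair_insert (by rw [Finset.card_erase_of_mem hb]; have := hS.1; omega) ha

theorem ProperPair.exists_exchange {g : α → γ} {S : Finset α} (hS : ProperPair g S) {a : α}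
    (h : ¬ (S.card ≤ 1 ∧ g a ∉ S.image g)) : ∃ b ∈ S, g a ∉ (S.erase b).image g := by
  by_cases ha : g a ∈ S.image g
  · obtain ⟨b, hb, hab⟩ := Finset.mem_image.1 ha
    refine ⟨b, hb, fun h' => ?_⟩
    obtain ⟨d, hd, hda⟩ := Finset.mem_image.1 h'
    exact (Finset.mem_erase.1 hd).1
      (hS.2 (Finset.mem_of_mem_erase hd) hb (hda.trans hab.symm))
  · have hc : 0 < S.card := by by_contra h0; exact h ⟨by omega, ha⟩
    obtain ⟨b, hb⟩ := Finset.card_pos.1 hc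
    exact ⟨b, hb, fun h' => ha (Finset.image_subset_image (Finset.erase_subset _ _) h')⟩

/-- The vertices joined to a given vertex in a color that survives the deletion of any one edge
of `F`, where `S` is the set of neighbors and `F ⊆ S`. -/
theorem ProperPair.card_blocked_add_le [Fintype α] {g : α → γ} {S F : Finset α} {e : ℕ}
    (hS : ProperPair g S) (hF : F ⊆ S) (hne : F.Nonempty)
    (he : ∀ k, (Finset.univ.filter fun a => g a = k).card ≤ e + 1) :
    (Finset.univ.filter fun a => a ∉ S ∧ ∀ b ∈ F, g a ∈ (S.erase b).image g).card
      + e * F.card ≤ 2 * e := by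
  have hF2 : F.card ≤ 2 := (Finset.card_le_card hF).trans hS.1
  have hF0 := hne.card_pos
  set B := Finset.univ.filter fun a => a ∉ S ∧ ∀ b ∈ F, g a ∈ (S.erase b).image g with hB
  obtain h1 | h2 : F.card = 1 ∨ F.card = 2 := by omega
  · obtain ⟨b, rfl⟩ := Finset.card_eq_one.1 h1
    have hb : b ∈ S := hF (Finset.mem_singleton_self b)
    suffices B.card ≤ e by rw [h1]; omega
    by_cases hr : (S.erase b).Nonempty
    · obtain ⟨r, hr⟩ := hr
      have hone : (S.erase b).card ≤ 1 := by
        rw [Finset.card_erase_of_mem hb]; have := hS.1; omega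
      have hsub : B ⊆ (Finset.univ.filter fun a => g a = g r).erase r := by
        intro a ha
        obtain ⟨haS, hab⟩ := (Finset.mem_filter.1 ha).2
        obtain ⟨d, hd, hda⟩ := Finset.mem_image.1 (hab b (Finset.mem_singleton_self b))
        obtain rfl := Finset.card_le_one.1 hone d hd r hr
        refine Finset.mem_erase.2 ⟨?_, Finset.mem_filter.2 ⟨Finset.mem_univ _, hda.symm⟩⟩
        rintro rfl
        exact haS (Finset.mem_of_mem_erase hd)
      have := Finset.card_le_card hsub
      rw [Finset.card_erase_of_mem (by simp)] at this
      have := he (g r)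
      omega
    · have : B = ∅ := by
        rw [Finset.not_nonempty_iff_eq_empty] at hr
        simp only [hB, Finset.mem_singleton, forall_eq, hr]
        simp
      simp [this]
  · have hFS : F = S := Finset.eq_of_subset_of_card_le hF (by have := hS.1; omega)
    have : B = ∅ := by
      refine Finset.eq_empty_of_forall_notMem fun a ha => ?_
      obtain ⟨-, hab⟩ := (Finset.mem_filter.1 ha).2
      obtain ⟨b, d, hbd, hFbd⟩ := Finset.card_eq_two.1 h2
      have hbF : b ∈ F := by simp [hFbd]
      have hdF : d ∈ F := by simp [hFbd]
      have hb := hab b hbF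
      have hd := hab d hdF
      rw [← hFS] at hb hd
      have hinj := hS.2
      rw [← hFS] at hinj
      simp only [Finset.mem_image, Finset.mem_erase] at hb hd
      obtain ⟨b', ⟨hb1, hb2⟩, hb3⟩ := hb
      obtain ⟨d', ⟨hd1, hd2⟩, hd3⟩ := hd
      have := hinj hb2 hd2 (hb3.trans hd3.symm)
      rw [hFbd] at hb2
      simp only [Finset.mem_insert, Finset.mem_singleton] at hb2
      grind
    rw [this, h2]
    simp
    omega

theorem sum_card_blocked_add_le [Fintype β] {f : α → β → γ} {R : α → Finset β} {e : ℕ}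
    (hR : ∀ a, ProperPair (f a) (R a))
    (he : ∀ a k, (Finset.univ.filter fun b => f a b = k).card ≤ e + 1)
    (W : Finset β) (φ : β → α) (hφ : ∀ b ∈ W, b ∈ R (φ b)) :
    ∑ a ∈ W.image φ, (Finset.univ.filter fun b =>
        b ∉ R a ∧ ∀ d ∈ W, φ d = a → f a b ∈ ((R a).erase d).image (f a)).card
      + e * W.card ≤ 2 * e * (W.image φ).card := by
  rw [Finset.card_eq_sum_card_image φ W, Finset.mul_sum, ← Finset.sum_add_distrib, mul_comm,
    ← smul_eq_mul, ← Finset.sum_const]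
  refine Finset.sum_le_sum fun a ha => ?_
  have h := (hR a).card_blocked_add_le (F := W.filter fun d => φ d = a)
    (fun d hd => by
      obtain ⟨hdW, rfl⟩ := Finset.mem_filter.1 hd
      exact hφ d hdW)
    (by
      obtain ⟨d, hd, hda⟩ := Finset.mem_image.1 ha
      exact ⟨d, Finset.mem_filter.2 ⟨hd, hda⟩⟩) (he a)
  simpa only [Finset.mem_filter, and_imp] using h

/-- The neighbors of `x` in the bipartite graph with edge set `E`. -/
def rowNbrs [Fintype β] (E : Finset (α × β)) (x : α) : Finset β :=
  Finset.univ.filter fun y => (x, y) ∈ E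

/-- The neighbors of `y` in the bipartite graph with edge set `E`. -/
def colNbrs [Fintype α] (E : Finset (α × β)) (y : β) : Finset α :=
  Finset.univ.filter fun x => (x, y) ∈ E

@[simp] theorem mem_rowNbrs [Fintype β] {E : Finset (α × β)} {x : α} {y : β} :
    y ∈ rowNbrs E x ↔ (x, y) ∈ E := by simp [rowNbrs]

@[simp] theorem mem_colNbrs [Fintype α] {E : Finset (α × β)} {x : α} {y : β} :
    x ∈ colNbrs E y ↔ (x, y) ∈ E := by simp [colNbrs]

variable [Fintype α] [Fintype β]

theorem card_eq_sum_rowNbrs (E : Finset (α × β)) : E.card = ∑ x, (rowNbrs E x).card := by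
  rw [Finset.card_eq_sum_card_fiberwise (f := Prod.fst) (t := Finset.univ) (by simp)]
  refine Finset.sum_congr rfl fun x _ => ?_
  refine Finset.card_nbij' Prod.snd (fun y => (x, y)) ?_ ?_ ?_ ?_ <;>
    (simp +contextual [Set.MapsTo, Set.LeftInvOn]; try grind)

theorem card_eq_sum_colNbrs (E : Finset (α × β)) : E.card = ∑ y, (colNbrs E y).card := by
  rw [Finset.card_eq_sum_card_fiberwise (f := Prod.snd) (t := Finset.univ) (by simp)]
  refine Finset.sum_congr rfl fun y _ => ?_
  refine Finset.card_nbij' Prod.fst (fun x => (x, y)) ?_ ?_ ?_ ?_ <;>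
    (simp +contextual [Set.MapsTo, Set.LeftInvOn]; try grind)

/-- The edge set of a properly colored subgraph of maximum degree at most two. -/
def IsPCTwoMatching (f : α → β → γ) (E : Finset (α × β)) : Prop :=
  (∀ x, ProperPair (f x) (rowNbrs E x)) ∧ ∀ y, ProperPair (fun x => f x y) (colNbrs E y)

theorem IsPCTwoMatching.insert_edge {f : α → β → γ} {E : Finset (α × β)} (hE : IsPCTwoMatching f E)
    {x : α} {y : β} (hx : (rowNbrs E x).card ≤ 1) (hxy : f x y ∉ (rowNbrs E x).image (f x))
    (hy : (colNbrs E y).card ≤ 1) (hyx : f x y ∉ (colNbrs E y).image fun x => f x y) :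
    IsPCTwoMatching f (insert (x, y) E) := by
  constructor
  · intro i
    by_cases hi : i = x
    · subst hi
      refine (properPair_insert hx hxy).mono fun j => ?_
      simp
    · refine (hE.1 i).mono fun j => ?_
      simp [hi]
  · intro j
    by_cases hj : j = y
    · subst hj
      refine (properPair_insert (g := fun x => f x j) hy hyx).mono fun i => ?_
      simp
    · refine (hE.2 j).mono fun i => ?_
      simp [hj]

/-- Moving the deficiency from `x` to `u` via `w` and from `y` to `v` via `z`, and then adding the
edge `uv`. -/
theorem IsPCTwoMatching.double_exchange {f : α → β → γ} {E : Finset (α × β)}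
    (hE : IsPCTwoMatching f E) {x u z : α} {y v w : β}
    (hx : (rowNbrs E x).card ≤ 1) (hxw : f x w ∉ (rowNbrs E x).image (f x))
    (hy : (colNbrs E y).card ≤ 1) (hyz : f z y ∉ (colNbrs E y).image fun x => f x y)
    (huw : (u, w) ∈ E) (hzv : (z, v) ∈ E) (huv : (u, v) ∉ E) (hwy : w ≠ y) (hzx : z ≠ x)
    (hw : f x w ∉ ((colNbrs E w).erase u).image fun x => f x w)
    (hz : f z y ∉ ((rowNbrs E z).erase v).image (f z))
    (hu : f u v ∉ ((rowNbrs E u).erase w).image (f u))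
    (hv : f u v ∉ ((colNbrs E v).erase z).image fun x => f x v) :
    ∃ E', IsPCTwoMatching f E' ∧ E.card < E'.card := by
  have hxw' : (x, w) ∉ E := fun h => hxw (Finset.mem_image_of_mem _ (by simpa using h))
  have hzy' : (z, y) ∉ E := fun h =>
    hyz (Finset.mem_image_of_mem (fun x => f x y) (by simpa using h))
  have hux : u ≠ x := by rintro rfl; exact hxw' huw
  have hvy : v ≠ y := by rintro rfl; exact hzy' hzv
  have huz : u ≠ z := by rintro rfl; exact huv hzv
  have hwv : w ≠ v := by rintro rfl; exact huv huw
  refine ⟨insert (x, w) (insert (z, y) (insert (u, v) ((E.erase (u, w)).erase (z, v)))),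
    ⟨fun i => ?_, fun j => ?_⟩, ?_⟩
  · by_cases hi : i = x
    · subst hi
      refine (properPair_insert hx hxw).mono fun j => ?_
      grind [mem_rowNbrs]
    by_cases hi : i = u
    · subst hi
      refine ((hE.1 i).exchange (by simpa using huw) hu).mono fun j => ?_
      grind [mem_rowNbrs]
    by_cases hi : i = z
    · subst hi
      refine ((hE.1 i).exchange (by simpa using hzv) hz).mono fun j => ?_
      grind [mem_rowNbrs]
    refine (hE.1 i).mono fun j => ?_
    grind [mem_rowNbrs]
  · by_cases hj : j = y
    · subst hj
      refine (properPair_insert (g := fun x => f x j) hy hyz).mono fun i => ?_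
      grind [mem_colNbrs]
    by_cases hj : j = v
    · subst hj
      refine ((hE.2 j).exchange (by simpa using hzv) hv).mono fun i => ?_
      grind [mem_colNbrs]
    by_cases hj : j = w
    · subst hj
      refine ((hE.2 j).exchange (by simpa using huw) hw).mono fun i => ?_
      grind [mem_colNbrs]
    refine (hE.2 j).mono fun i => ?_
    grind [mem_colNbrs]
  · rw [Finset.card_insert_of_notMem, Finset.card_insert_of_notMem,
      Finset.card_insert_of_notMem, Finset.card_erase_of_mem, Finset.card_erase_of_mem huw]
    · have : 1 < E.card := Finset.one_lt_card.2 ⟨_, huw, _, hzv, by simp [huz]⟩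
      omega
    all_goals simp only [Finset.mem_insert, Finset.mem_erase, Prod.mk.injEq]; grind

/-- The color conditions leave many vertices to which a deficient vertex can be joined. -/
theorem exists_subset_admissible {g : α → γ} {S : Finset α} {e M : ℕ} (hS : S.card ≤ 1)
    (he : ∀ k, (Finset.univ.filter fun a => g a = k).card ≤ e + 1)
    (hM : M + e + 2 ≤ Fintype.card α) (a₀ : α) :
    ∃ W : Finset α, W.card = M ∧ ∀ a ∈ W, a ≠ a₀ ∧ g a ∉ S.image g := by
  have hcard : (Finset.univ.filter fun a => g a ∈ S.image g).card ≤ e + 1 := by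
    obtain h0 | h1 : S.card = 0 ∨ S.card = 1 := by omega
    · simp [Finset.card_eq_zero.1 h0]
    · obtain ⟨s, rfl⟩ := Finset.card_eq_one.1 h1
      simpa using he (g s)
  have hle : M ≤ ((Finset.univ.filter fun a => ¬ g a ∈ S.image g).erase a₀).card := by
    have h1 := Finset.card_filter_add_card_filter_not (s := Finset.univ)
      (fun a => g a ∈ S.image g)
    have h2 := Finset.pred_card_le_card_erase
      (s := Finset.univ.filter fun a => ¬ g a ∈ S.image g) (a := a₀)
    rw [Finset.card_univ] at h1
    omega
  obtain ⟨W, hW, hWM⟩ := Finset.exists_subset_card_eq hle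
  refine ⟨W, hWM, fun a ha => ?_⟩
  have := hW ha
  simp only [Finset.mem_erase, Finset.mem_filter, Finset.mem_univ, true_and] at this
  exact this

theorem IsPCTwoMatching.exists_larger {f : α → β → γ} {E : Finset (α × β)} {e : ℕ}
    (hE : IsPCTwoMatching f E)
    (hα : 3 * e + 9 ≤ Fintype.card α) (hβ : 3 * e + 9 ≤ Fintype.card β)
    (hrow : ∀ x k, (Finset.univ.filter fun y => f x y = k).card ≤ e + 1)
    (hcol : ∀ y k, (Finset.univ.filter fun x => f x y = k).card ≤ e + 1)
    {x : α} {y : β} (hx : (rowNbrs E x).card ≤ 1) (hy : (colNbrs E y).card ≤ 1) :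
    ∃ E', IsPCTwoMatching f E' ∧ E.card < E'.card := by
  by_contra hmax
  obtain ⟨W, hWM, hW⟩ := exists_subset_admissible (M := 2 * e + 7) hx (hrow x) (by omega) y
  obtain ⟨Z, hZM, hZ⟩ := exists_subset_admissible (M := 2 * e + 7) hy (hcol y) (by omega) x
  have hins : ∀ {x : α} {y : β}, (rowNbrs E x).card ≤ 1 → f x y ∉ (rowNbrs E x).image (f x) →
      (colNbrs E y).card ≤ 1 → f x y ∉ ((colNbrs E y).image fun x => f x y) → False := by
    intro x y hx hxy hy hyx
    refine hmax ⟨_, hE.insert_edge hx hxy hy hyx, ?_⟩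
    rw [Finset.card_insert_of_notMem fun h =>
      hxy (Finset.mem_image_of_mem _ (by simpa using h))]
    omega
  have hφ : ∀ w, ∃ u, w ∈ W → u ∈ colNbrs E w ∧
      f x w ∉ ((colNbrs E w).erase u).image fun x => f x w := by
    intro w
    by_cases hw : w ∈ W
    · obtain ⟨u, hu⟩ := (hE.2 w).exists_exchange (a := x)
        fun h => hins hx (hW w hw).2 h.1 h.2
      exact ⟨u, fun _ => hu⟩
    · exact ⟨x, fun h => absurd h hw⟩
  have hψ : ∀ z, ∃ v, z ∈ Z → v ∈ rowNbrs E z ∧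
      f z y ∉ ((rowNbrs E z).erase v).image (f z) := by
    intro z
    by_cases hz : z ∈ Z
    · obtain ⟨v, hv⟩ := (hE.1 z).exists_exchange (a := y)
        fun h => hins h.1 h.2 hy (hZ z hz).2
      exact ⟨v, fun _ => hv⟩
    · exact ⟨y, fun h => absurd h hz⟩
  choose φ hφ using hφ
  choose ψ hψ using hψ
  have hU := sum_card_blocked_add_le hE.1 hrow W φ
    fun w hw => by simpa using (hφ w hw).1
  have hV := sum_card_blocked_add_le (f := fun y x => f x y) hE.2 hcol Z ψ
    fun z hz => by simpa using (hψ z hz).1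
  set U := W.image φ with hUdef
  set V := Z.image ψ with hVdef
  set BU : α → Finset β := fun a => Finset.univ.filter fun b =>
    b ∉ rowNbrs E a ∧ ∀ d ∈ W, φ d = a → f a b ∈ ((rowNbrs E a).erase d).image (f a) with hBU
  set BV : β → Finset α := fun b => Finset.univ.filter fun a =>
    a ∉ colNbrs E b ∧ ∀ d ∈ Z, ψ d = b →
      f a b ∈ ((colNbrs E b).erase d).image fun x => f x b with hBV
  change ∑ a ∈ U, (BU a).card + _ ≤ _ at hU
  change ∑ b ∈ V, (BV b).card + _ ≤ _ at hV
  have hcover : U ×ˢ V ⊆ (U.sigma fun a => rowNbrs E a).image (fun p => (p.1, p.2)) ∪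
      (U.sigma BU).image (fun p => (p.1, p.2)) ∪
      (V.sigma BV).image (fun p => (p.2, p.1)) := by
    rintro ⟨u, v⟩ huv
    obtain ⟨hu, hv⟩ := Finset.mem_product.1 huv
    by_contra hnot
    simp only [Finset.mem_union, Finset.mem_image, Finset.mem_sigma, Prod.mk.injEq, not_or,
      not_exists, not_and] at hnot
    obtain ⟨⟨h1, h2⟩, h3⟩ := hnot
    have huvE : (u, v) ∉ E := fun h => h1 ⟨u, v⟩ ⟨hu, by simpa using h⟩ rfl rfl
    have h2' : v ∉ BU u := fun h => h2 ⟨u, v⟩ ⟨hu, h⟩ rfl rfl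
    have h3' : u ∉ BV v := fun h => h3 ⟨v, u⟩ ⟨hv, h⟩ rfl rfl
    simp only [hBU, Finset.mem_filter, Finset.mem_univ, true_and, mem_rowNbrs, huvE,
      not_false_eq_true, not_forall] at h2'
    simp only [hBV, Finset.mem_filter, Finset.mem_univ, true_and, mem_colNbrs, huvE,
      not_false_eq_true, not_forall] at h3'
    obtain ⟨w, hw, rfl, hwu⟩ := h2'
    obtain ⟨z, hz, rfl, hzv⟩ := h3'
    exact hmax (hE.double_exchange hx (hW w hw).2 hy (hZ z hz).2
      (by simpa using (hφ w hw).1) (by simpa using (hψ z hz).1) huvE (hW w hw).1 (hZ z hz).1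
      (hφ w hw).2 (hψ z hz).2 hwu hzv)
  have hcard := (Finset.card_le_card hcover).trans
    ((Finset.card_union_le _ _).trans (Nat.add_le_add_right (Finset.card_union_le _ _) _))
  have hrows : (U.sigma fun a => rowNbrs E a).card ≤ 2 * U.card := by
    rw [Finset.card_sigma, mul_comm, ← smul_eq_mul, ← Finset.sum_const]
    exact Finset.sum_le_sum fun a _ => (hE.1 a).1
  have h1 := (Finset.card_image_le (s := U.sigma fun a => rowNbrs E a)
    (f := fun p => (p.1, p.2))).trans hrows
  have h2 := Finset.card_image_le (s := U.sigma BU) (f := fun p => (p.1, p.2))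
  have h3 := Finset.card_image_le (s := V.sigma BV) (f := fun p => (p.2, p.1))
  rw [Finset.card_sigma] at h2 h3
  rw [Finset.card_product] at hcard
  have hUM : U.card ≤ 2 * e + 7 := hWM ▸ Finset.card_image_le
  have hVM : V.card ≤ 2 * e + 7 := hZM ▸ Finset.card_image_le
  have hUm : 2 * e + 7 ≤ 2 * U.card := by
    rw [← hWM]
    refine Finset.card_le_mul_card_image W 2 fun u _ => le_trans (Finset.card_le_card ?_) (hE.1 u).1
    intro w hw
    obtain ⟨hwW, rfl⟩ := Finset.mem_filter.1 hw
    simpa using (hφ w hwW).1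
  have hVm : 2 * e + 7 ≤ 2 * V.card := by
    rw [← hZM]
    refine Finset.card_le_mul_card_image Z 2 fun v _ => le_trans (Finset.card_le_card ?_) (hE.2 v).1
    intro z hz
    obtain ⟨hzZ, rfl⟩ := Finset.mem_filter.1 hz
    simpa using (hψ z hzZ).1
  rw [hWM] at hU
  rw [hZM] at hV
  have key : U.card * V.card + 2 * e * (2 * e + 7) ≤
      2 * U.card + 2 * e * U.card + 2 * e * V.card := by nlinarith
  exact absurd key (not_le.2 (lt_mul_add_of_mem_Icc (by omega) hUM (by omega) hVM))

end TwoMatching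

theorem card_filter_color_le {α γ : Type*} [Fintype α] [DecidableEq γ] {g : α → γ} {e : ℕ}
    (h : Fintype.card α ≤ (Finset.univ.image g).card + e) (k : γ) :
    (Finset.univ.filter fun a => g a = k).card ≤ e + 1 := by
  have h1 := Finset.card_filter_add_card_filter_not (s := Finset.univ) (fun a => g a = k)
  have h2 : (Finset.univ.image g).card ≤ (Finset.univ.filter fun a => ¬ g a = k).card + 1 := by
    refine (Finset.card_le_card (t := insert k ((Finset.univ.filter fun a => ¬ g a = k).image g))
      ?_).trans ((Finset.card_insert_le _ _).trans (by gcongr; exact Finset.card_image_le))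
    intro j hj
    obtain ⟨a, -, rfl⟩ := Finset.mem_image.1 hj
    by_cases ha : g a = k
    · simp [ha]
    · exact Finset.mem_insert_of_mem (Finset.mem_image_of_mem _ (by simp [ha]))
  rw [Finset.card_univ] at h1
  omega

/-- A maximum properly colored subgraph of maximum degree at most two is 2-regular. -/
theorem exists_isPCTwoMatching_regular {α γ : Type*} [Fintype α] [DecidableEq α]
    [DecidableEq γ] {f : α → α → γ} {e : ℕ} (hn : 3 * e + 9 ≤ Fintype.card α)
    (hrow : ∀ x k, (Finset.univ.filter fun y => f x y = k).card ≤ e + 1)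
    (hcol : ∀ y k, (Finset.univ.filter fun x => f x y = k).card ≤ e + 1) :
    ∃ E : Finset (α × α), IsPCTwoMatching f E ∧ (∀ x, (rowNbrs E x).card = 2) ∧
      ∀ y, (colNbrs E y).card = 2 := by
  classical
  obtain ⟨E, hE, hmax⟩ := Finset.exists_max_image
    (Finset.univ.filter fun E : Finset (α × α) => IsPCTwoMatching f E) Finset.card
    ⟨∅, by simp [IsPCTwoMatching, ProperPair, rowNbrs, colNbrs]⟩
  replace hE := (Finset.mem_filter.1 hE).2
  have hno : ¬ ∃ E', IsPCTwoMatching f E' ∧ E.card < E'.card := fun ⟨E', h, hlt⟩ =>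
    absurd (hmax E' (by simpa using h)) (not_le.2 hlt)
  have hr := card_eq_sum_rowNbrs E
  have hc := card_eq_sum_colNbrs E
  have htwo : ∑ _x : α, 2 = Fintype.card α * 2 := by simp
  have hr_iff := Finset.sum_eq_sum_iff_of_le (s := Finset.univ) fun x _ => (hE.1 x).1
  have hc_iff := Finset.sum_eq_sum_iff_of_le (s := Finset.univ) fun y _ => (hE.2 y).1
  rw [← hr] at hr_iff
  rw [← hc] at hc_iff
  by_cases hcard : E.card = ∑ _x : α, 2
  · exact ⟨E, hE, fun x => hr_iff.1 hcard x (Finset.mem_univ x),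
      fun y => hc_iff.1 hcard y (Finset.mem_univ y)⟩
  · have h1 := mt hr_iff.2 hcard
    have h2 := mt hc_iff.2 hcard
    push Not at h1 h2
    obtain ⟨x, -, hx⟩ := h1
    obtain ⟨y, -, hy⟩ := h2
    have := (hE.1 x).1
    have := (hE.2 y).1
    exact absurd (hE.exists_larger hn hn hrow hcol (x := x) (y := y) (by omega) (by omega)) hno

/-- The subgraph of `K_{n,n}` with edge set `E`. -/
def edgeGraph {n : ℕ} (E : Finset (Fin n × Fin n)) : SimpleGraph (V2 n) where
  Adj
    | Sum.inl x, Sum.inr y => (x, y) ∈ E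
    | Sum.inr y, Sum.inl x => (x, y) ∈ E
    | _, _ => False
  symm := ⟨by rintro (x | x) (y | y) h <;> exact h⟩
  loopless := ⟨by rintro (x | x) h <;> exact h⟩

theorem neighborSet_edgeGraph_inl {n : ℕ} (E : Finset (Fin n × Fin n)) (x : Fin n) :
    (edgeGraph E).neighborSet (Sum.inl x) = Sum.inr '' (rowNbrs E x : Set (Fin n)) := by
  ext (v | v) <;> simp [edgeGraph]

theorem neighborSet_edgeGraph_inr {n : ℕ} (E : Finset (Fin n × Fin n)) (y : Fin n) :
    (edgeGraph E).neighborSet (Sum.inr y) = Sum.inl '' (colNbrs E y : Set (Fin n)) := by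
  ext (v | v) <;> simp [edgeGraph]

theorem isPC2Factor_edgeGraph {n : ℕ} {c : V2 n → V2 n → ℕ} (hsym : ∀ u v, c u v = c v u)
    {E : Finset (Fin n × Fin n)} (hE : IsPCTwoMatching (fun x y => c (Sum.inl x) (Sum.inr y)) E)
    (hrow : ∀ x, (rowNbrs E x).card = 2) (hcol : ∀ y, (colNbrs E y).card = 2) :
    IsPC2Factor n c (edgeGraph E) := by
  refine ⟨?_, ?_, ?_⟩
  · rintro (x | x) (y | y) h
    · exact h.elim
    · simp [KBB]
    · simp [KBB]
    · exact h.elim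
  · rintro (x | y)
    · rw [neighborSet_edgeGraph_inl, Set.ncard_image_of_injective _ Sum.inr_injective,
        Set.ncard_coe_finset, hrow]
    · rw [neighborSet_edgeGraph_inr, Set.ncard_image_of_injective _ Sum.inl_injective,
        Set.ncard_coe_finset, hcol]
  · rintro (x | y) v w hv hw hvw heq
    · rw [← SimpleGraph.mem_neighborSet, neighborSet_edgeGraph_inl] at hv hw
      obtain ⟨v, hv, rfl⟩ := hv
      obtain ⟨w, hw, rfl⟩ := hw
      exact hvw (congrArg _ ((hE.1 x).2 hv hw heq))
    · rw [← SimpleGraph.mem_neighborSet, neighborSet_edgeGraph_inr] at hv hw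
      obtain ⟨v, hv, rfl⟩ := hv
      obtain ⟨w, hw, rfl⟩ := hw
      rw [hsym, hsym (Sum.inr y)] at heq
      exact hvw (congrArg _ ((hE.2 y).2 hv hw heq))

/-- Corollary 1.6.  Every edge-colored `K_{n,n}` with
`δ^c ≥ 2n/3 + 3` contains a PC 2-factor. -/
theorem pc_two_factor (n : ℕ) (c : V2 n → V2 n → ℕ) (hsym : ∀ u v, c u v = c v u)
    (hdeg : ∀ v, (2 * n : ℝ) / 3 + 3 ≤ (colorDeg n c v : ℝ)) :
    ∃ H : SimpleGraph (V2 n), IsPC2Factor n c H := by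
  obtain rfl | hn := Nat.eq_zero_or_pos n
  · exact ⟨⊥, bot_le, fun v => isEmptyElim v, fun u => isEmptyElim u⟩
  have hdeg' : ∀ v, 2 * n + 9 ≤ 3 * colorDeg n c v := fun v => by
    have h := hdeg v
    have : (2 * n + 9 : ℝ) ≤ 3 * colorDeg n c v := by linarith
    exact_mod_cast this
  have hle : colorDeg n c (Sum.inl ⟨0, hn⟩) ≤ n :=
    Finset.card_image_le.trans (by simp)
  have h0 := hdeg' (Sum.inl ⟨0, hn⟩)
  have hclass : ∀ v, n ≤ colorDeg n c v + (n - 9) / 3 := fun v => by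
    have := hdeg' v
    omega
  obtain ⟨E, hE, hr, hc⟩ := exists_isPCTwoMatching_regular (e := (n - 9) / 3)
    (f := fun x y => c (Sum.inl x) (Sum.inr y)) (by rw [Fintype.card_fin]; omega)
    (fun x => card_filter_color_le (by simpa using! hclass (Sum.inl x)))
    (fun y => card_filter_color_le (by
      simp only [hsym _ (Sum.inr y)]
      simpa using! hclass (Sum.inr y)))
  exact ⟨_, isPC2Factor_edgeGraph hsym hE hr hc⟩
end

section
/- Let t ≥ 3 be an integer. If K^c_{n,n} is an edge-colored complete balanced bipartite graph with minimum color degree δ^c(K^c_{n,n}) ≥ 2n/3 + t, then the vertex set of K^c_{n,n} can be covered by at most ⌈2n/t⌉ pairwise vertex-disjoint properly colored paths of odd length (i.e., paths with one endpoint in each part). -/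
open SimpleGraph

section
variable {V : Type*}

/-- Every walk of `G` from `u` to `v` has length at least `m`. -/
def FarApart (G : SimpleGraph V) (m : ℕ) (u v : V) : Prop :=
  ∀ p : G.Walk u v, m ≤ p.length

theorem FarApart.symm {G : SimpleGraph V} {m : ℕ} {u v : V} (h : FarApart G m u v) :
    FarApart G m v u := fun p => by simpa using h p.reverse

theorem FarApart.anti {G G' : SimpleGraph V} {m k : ℕ} {u v : V} (h : FarApart G' m u v)
    (hG : G ≤ G') (hk : k ≤ m) : FarApart G k u v := fun p => by
  have := h (p.mapLe hG)
  rw [Walk.length_map] at this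
  omega

theorem FarApart.ne {G : SimpleGraph V} {m : ℕ} {u v : V} (h : FarApart G m u v)
    (hm : 1 ≤ m) : u ≠ v := by
  rintro rfl
  have := h Walk.nil
  simp at this
  omega

theorem farApart_one {G : SimpleGraph V} {u v : V} (h : u ≠ v) : FarApart G 1 u v := fun p => by
  cases p with
  | nil => exact absurd rfl h
  | cons _ _ => simp

theorem FarApart.of_adj {G : SimpleGraph V} {m : ℕ} {u v w : V} (h : FarApart G (m + 1) u v)
    (hw : G.Adj v w) : FarApart G m u w := fun p => by
  have := h (p.concat hw.symm)
  rw [Walk.length_concat] at this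
  omega

/-- A walk that uses an added edge contains a portion before and a portion after it. -/
theorem exists_walk_split_of_sup_edge {G : SimpleGraph V} {u v a b : V}
    (p : (G ⊔ edge u v).Walk a b) :
    (∃ q : G.Walk a b, q.length ≤ p.length) ∨
      ∃ x y, (x = u ∧ y = v ∨ x = v ∧ y = u) ∧
        ∃ (q₁ : G.Walk a x) (q₂ : G.Walk y b), q₁.length + q₂.length + 1 ≤ p.length := by
  induction p with
  | nil => exact Or.inl ⟨Walk.nil, by simp⟩
  | @cons a a' b h p ih =>
    rw [sup_adj, edge_adj] at h
    rcases h with h | ⟨h, -⟩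
    · rcases ih with ⟨q, hq⟩ | ⟨x, y, hxy, q₁, q₂, hq⟩
      · exact Or.inl ⟨Walk.cons h q, by simpa using hq⟩
      · refine Or.inr ⟨x, y, hxy, Walk.cons h q₁, q₂, ?_⟩
        simp only [Walk.length_cons]
        omega
    · rcases ih with ⟨q, hq⟩ | ⟨x, y, hxy, q₁, q₂, hq⟩
      · refine Or.inr ⟨a, a', by grind, Walk.nil, q, ?_⟩
        simp only [Walk.length_cons, Walk.length_nil]
        omega
      · by_cases hx : a = x
        · subst hx
          refine Or.inr ⟨a, y, hxy, Walk.nil, q₂, ?_⟩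
          simp only [Walk.length_cons, Walk.length_nil]
          omega
        · obtain rfl : y = a := by grind
          refine Or.inl ⟨q₂, ?_⟩
          simp only [Walk.length_cons]
          omega

theorem FarApart.sup_edge {G : SimpleGraph V} {u v a b : V} {m m₁ m₂ : ℕ}
    (h : FarApart G m a b) (hu : FarApart G m₁ a u) (hv : FarApart G m₁ a v)
    (hu' : FarApart G m₂ u b) (hv' : FarApart G m₂ v b) (hm : m ≤ m₁ + m₂ + 1) :
    FarApart (G ⊔ edge u v) m a b := fun p => by
  rcases exists_walk_split_of_sup_edge p with ⟨q, hq⟩ | ⟨x, y, hxy, q₁, q₂, hq⟩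
  · exact (h q).trans hq
  · have h₁ : m₁ ≤ q₁.length := by
      rcases hxy with ⟨rfl, rfl⟩ | ⟨rfl, rfl⟩
      exacts [hu q₁, hv q₁]
    have h₂ : m₂ ≤ q₂.length := by
      rcases hxy with ⟨rfl, rfl⟩ | ⟨rfl, rfl⟩
      exacts [hv' q₂, hu' q₂]
    omega

/-- A properly colored bipartite graph of maximum degree at most two in which every cycle has
length at least `t`. -/
structure IsPCSystem (s : V → Bool) (c : V → V → ℕ) (t : ℕ) (H : SimpleGraph V) : Prop where
  bip : ∀ u v, H.Adj u v → s u ≠ s v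
  deg : ∀ v x y z, H.Adj v x → H.Adj v y → H.Adj v z → x = y ∨ x = z ∨ y = z
  pc : ∀ v x y, H.Adj v x → H.Adj v y → x ≠ y → c v x ≠ c v y
  girth : ∀ u v, H.Adj u v → FarApart (H.deleteEdges {s(u, v)}) (t - 1) u v

/-- The vertex `v` has degree at most one. -/
def Deficient (H : SimpleGraph V) (v : V) : Prop :=
  ∀ x y, H.Adj v x → H.Adj v y → x = y

variable {s : V → Bool} {c : V → V → ℕ} {t : ℕ}

theorem isPCSystem_bot : IsPCSystem s c t ⊥ := by
  constructor <;> simp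

theorem IsPCSystem.anti {G H : SimpleGraph V} (hH : IsPCSystem s c t H) (h : G ≤ H) :
    IsPCSystem s c t G where
  bip _ _ h' := hH.bip _ _ (h h')
  deg _ _ _ _ h₁ h₂ h₃ := hH.deg _ _ _ _ (h h₁) (h h₂) (h h₃)
  pc _ _ _ h₁ h₂ := hH.pc _ _ _ (h h₁) (h h₂)
  girth _ _ h' := (hH.girth _ _ (h h')).anti (deleteEdges_mono h) le_rfl

/-- The edge `uv` can be added to `G` without violating the degree or color conditions. -/
structure Addable (s : V → Bool) (c : V → V → ℕ) (G : SimpleGraph V) (u v : V) : Prop where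
  side : s u ≠ s v
  left : Deficient G u
  right : Deficient G v
  color_left : ∀ x, G.Adj u x → c u v ≠ c u x
  color_right : ∀ x, G.Adj v x → c v u ≠ c v x

theorem Addable.not_adj {G : SimpleGraph V} {u v : V} (h : Addable s c G u v) : ¬G.Adj u v :=
  fun h' => h.color_left _ h' rfl

theorem sup_edge_adj_of_ne {G : SimpleGraph V} {u v x y : V} (hu : x ≠ u) (hv : x ≠ v) :
    (G ⊔ edge u v).Adj x y ↔ G.Adj x y := by
  rw [sup_adj, edge_adj]
  grind

theorem Addable.sup_edge {G : SimpleGraph V} {u v x y : V} (h : Addable s c G u v)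
    (h₁ : u ≠ x) (h₂ : u ≠ y) (h₃ : v ≠ x) (h₄ : v ≠ y) :
    Addable s c (G ⊔ edge x y) u v where
  side := h.side
  left a b := by
    rw [sup_edge_adj_of_ne h₁ h₂, sup_edge_adj_of_ne h₁ h₂]
    exact h.left a b
  right a b := by
    rw [sup_edge_adj_of_ne h₃ h₄, sup_edge_adj_of_ne h₃ h₄]
    exact h.right a b
  color_left a := by
    rw [sup_edge_adj_of_ne h₁ h₂]
    exact h.color_left a
  color_right a := by
    rw [sup_edge_adj_of_ne h₃ h₄]
    exact h.color_right a

theorem IsPCSystem.sup_edge {G : SimpleGraph V} {u v : V} (hG : IsPCSystem s c t G)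
    (h : Addable s c G u v) (hf : FarApart G (t - 1) u v) :
    IsPCSystem s c t (G ⊔ edge u v) where
  bip x y hxy := by
    rw [sup_adj, edge_adj] at hxy
    have := h.side
    rcases hxy with hxy | hxy
    · exact hG.bip _ _ hxy
    · grind
  deg x a b d ha hb hd := by
    simp only [sup_adj, edge_adj] at ha hb hd
    have h₁ := hG.deg x a b d
    have h₂ := h.left
    have h₃ := h.right
    grind [Deficient]
  pc x a b ha hb hab := by
    simp only [sup_adj, edge_adj] at ha hb
    have h₁ := hG.pc x a b
    have h₂ := h.color_left
    have h₃ := h.color_right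
    grind
  girth x y hxy p := by
    have huv : (G ⊔ edge u v).Adj u v := by
      rw [sup_adj, edge_adj]
      exact Or.inr ⟨Or.inl ⟨rfl, rfl⟩, fun e => h.side (congrArg s e)⟩
    by_cases he : s(x, y) = s(u, v)
    · have hle : (G ⊔ edge u v).deleteEdges {s(x, y)} ≤ G := by
        intro a b hab
        rw [deleteEdges_adj, he, sup_adj, edge_adj] at hab
        grind
      have : FarApart G (t - 1) x y := by
        rcases Sym2.eq_iff.1 he with ⟨rfl, rfl⟩ | ⟨rfl, rfl⟩
        exacts [hf, hf.symm]
      exact this.anti hle le_rfl p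
    · have hxy' : G.Adj x y := by
        rw [sup_adj, edge_adj] at hxy
        grind
      have hle : (G ⊔ edge u v).deleteEdges {s(x, y)} ≤ G.deleteEdges {s(x, y)} ⊔ edge u v := by
        intro a b hab
        simp only [deleteEdges_adj, sup_adj] at hab ⊢
        tauto
      have hp : (p.mapLe hle).length = p.length := Walk.length_map ..
      rcases exists_walk_split_of_sup_edge (p.mapLe hle) with ⟨q, hq⟩ | ⟨a, b, hab, q₁, q₂, hq⟩
      · have := hG.girth _ _ hxy' q
        omega
      · have hd : G.deleteEdges {s(x, y)} ≤ G := deleteEdges_le _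
        have hfar : FarApart G (t - 1) a b := by
          rcases hab with ⟨rfl, rfl⟩ | ⟨rfl, rfl⟩
          exacts [hf, hf.symm]
        have := hfar (((q₁.mapLe hd).reverse.concat hxy').append (q₂.mapLe hd).reverse)
        simp only [Walk.length_append, Walk.length_concat, Walk.length_reverse,
          Walk.length_map] at this
        omega

theorem IsPCSystem.exists_sup_edge [Finite V] {G : SimpleGraph V} {u v : V}
    (hG : IsPCSystem s c t G) (h : Addable s c G u v) (hf : FarApart G (t - 1) u v) :
    IsPCSystem s c t (G ⊔ edge u v) ∧
      (G ⊔ edge u v).edgeSet.ncard = G.edgeSet.ncard + 1 := by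
  refine ⟨hG.sup_edge h hf, ?_⟩
  have huv : u ≠ v := fun e => h.side (congrArg s e)
  rw [edgeSet_sup, edgeSet_edge_of_ne huv, Set.union_singleton,
    Set.ncard_insert_of_notMem (by simpa using h.not_adj)]

/-- The vertex `z` can be joined to `b` provided that the edge `bx` is deleted. -/
structure Exchange (s : V → Bool) (c : V → V → ℕ) (t : ℕ) (H : SimpleGraph V)
    (z w b x : V) : Prop where
  side : s z ≠ s b
  color_left : ∀ u, H.Adj z u → c z b ≠ c z u
  far_left : FarApart H (t - 1) z b
  far_right : FarApart H (t - 1) w b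
  adj : H.Adj b x
  color_right : ∀ u, H.Adj b u → u ≠ x → c b z ≠ c b u

theorem Exchange.addable {H G : SimpleGraph V} {z w b x : V} (h : Exchange s c t H z w b x)
    (hH : IsPCSystem s c t H) (hz : Deficient H z) (hG : G ≤ H) (hbx : ¬G.Adj b x) :
    Addable s c G z b where
  side := h.side
  left u v hu hv := hz u v (hG hu) (hG hv)
  right u v hu hv := by
    have := hH.deg b u v x (hG hu) (hG hv) h.adj
    grind
  color_left u hu := h.color_left u (hG hu)
  color_right u hu := h.color_right u (hG hu) (by rintro rfl; exact hbx hu)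

theorem IsPCSystem.exists_larger [Finite V] {H : SimpleGraph V} {z w b x a y : V}
    (hH : IsPCSystem s c t H) (ht : 3 ≤ t) (hz : Deficient H z) (hw : Deficient H w)
    (hzw : s z ≠ s w) (hb : Exchange s c t H z w b x) (ha : Exchange s c t H w z a y)
    (hxy : FarApart H t x y)
    (hx : ∀ u, H.Adj x u → u ≠ b → c x y ≠ c x u)
    (hy : ∀ u, H.Adj y u → u ≠ a → c y x ≠ c y u) :
    ∃ H', IsPCSystem s c t H' ∧ H.edgeSet.ncard < H'.edgeSet.ncard := by
  obtain ⟨k, rfl⟩ : ∃ k, t = k + 3 := ⟨t - 3, by omega⟩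
  set G := H.deleteEdges {s(b, x), s(a, y)} with hGdef
  have hGH : G ≤ H := deleteEdges_le _
  have hG : IsPCSystem s c (k + 3) G := hH.anti hGH
  have hGbx : ¬G.Adj b x := by simp [hGdef]
  have hGay : ¬G.Adj a y := by simp [hGdef]
  have sx := hH.bip _ _ hb.adj
  have sy := hH.bip _ _ ha.adj
  have sb := hb.side
  have sa := ha.side
  have hcard : H.edgeSet.ncard ≤ G.edgeSet.ncard + 2 := by
    rw [hGdef, edgeSet_deleteEdges]
    have h₁ := Set.le_ncard_sdiff ({s(b, x), s(a, y)} : Set (Sym2 V)) H.edgeSet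
    have h₂ : ({s(b, x), s(a, y)} : Set (Sym2 V)).ncard ≤ 2 :=
      (Set.ncard_insert_le _ _).trans (by rw [Set.ncard_singleton])
    omega
  -- distances in the graph with both edges deleted
  have zb : FarApart G (k + 2) z b := hb.far_left.anti hGH le_rfl
  have zx : FarApart G (k + 1) z x := (hb.far_left.of_adj hb.adj).anti hGH le_rfl
  have wb : FarApart G (k + 2) w b := hb.far_right.anti hGH le_rfl
  have wx : FarApart G (k + 1) w x := (hb.far_right.of_adj hb.adj).anti hGH le_rfl
  have wa : FarApart G (k + 2) w a := ha.far_left.anti hGH le_rfl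
  have wy : FarApart G (k + 1) w y := (ha.far_left.of_adj ha.adj).anti hGH le_rfl
  have za : FarApart G (k + 2) z a := ha.far_right.anti hGH le_rfl
  have zy : FarApart G (k + 1) z y := (ha.far_right.of_adj ha.adj).anti hGH le_rfl
  have xy : FarApart G (k + 3) x y := hxy.anti hGH le_rfl
  have xa' : FarApart H (k + 2) x a := hxy.of_adj ha.adj.symm
  have xa : FarApart G (k + 2) x a := xa'.anti hGH le_rfl
  have yb' : FarApart H (k + 2) y b := hxy.symm.of_adj hb.adj.symm
  have yb : FarApart G (k + 2) y b := yb'.anti hGH le_rfl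
  have ab : FarApart G (k + 1) a b :=
    ((xa'.symm).of_adj hb.adj.symm).anti hGH le_rfl
  have bx : FarApart G (k + 2) b x :=
    (hH.girth _ _ hb.adj).anti (deleteEdges_anti (by simp)) (by omega)
  have ay : FarApart G (k + 2) a y :=
    (hH.girth _ _ ha.adj).anti (deleteEdges_anti (by simp)) (by omega)
  have nzw : FarApart G 1 z w := farApart_one fun e => hzw (congrArg s e)
  have add₁ : Addable s c G z b := hb.addable hH hz hGH hGbx
  have add₃ : Addable s c G w a := ha.addable hH hw hGH hGay
  have add₂ : Addable s c G x y := by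
    have sxy : s x ≠ s y := by
      revert sx sy sb sa hzw
      cases s x <;> cases s y <;> cases s b <;> cases s a <;> cases s z <;> cases s w <;> decide
    refine ⟨sxy, fun u v hu hv => ?_, fun u v hu hv => ?_, fun u hu => ?_, fun u hu => ?_⟩
    · have := hH.deg x u v b (hGH hu) (hGH hv) hb.adj.symm
      have := G.adj_symm hu
      have := G.adj_symm hv
      grind
    · have := hH.deg y u v a (hGH hu) (hGH hv) ha.adj.symm
      have := G.adj_symm hu
      have := G.adj_symm hv
      grind
    · exact hx u (hGH hu) (by rintro rfl; exact hGbx hu.symm)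
    · exact hy u (hGH hu) (by rintro rfl; exact hGay hu.symm)
  have ne {u v : V} {m : ℕ} (h : FarApart G (m + 1) u v) : u ≠ v := h.ne (by omega)
  obtain ⟨s₁, e₁⟩ := hG.exists_sup_edge add₁ zb
  -- distances after adding `zb`
  have xy₁ : FarApart (G ⊔ edge z b) (k + 2) x y :=
    (xy.anti le_rfl (by omega)).sup_edge zx.symm (bx.symm.anti le_rfl (by omega)) zy
      (yb.symm.anti le_rfl (by omega)) (by omega)
  have wa₁ : FarApart (G ⊔ edge z b) (k + 2) w a :=
    wa.sup_edge nzw.symm (wb.anti le_rfl (by omega)) (za.anti le_rfl (by omega))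
      ab.symm (by omega)
  have xa₁ : FarApart (G ⊔ edge z b) (k + 1) x a :=
    (xa.anti le_rfl (by omega)).sup_edge zx.symm (bx.symm.anti le_rfl (by omega))
      (za.anti le_rfl (by omega)) ab.symm (by omega)
  have ya₁ : FarApart (G ⊔ edge z b) (k + 1) y a :=
    (ay.symm.anti le_rfl (by omega)).sup_edge zy.symm (yb.anti le_rfl (by omega))
      (za.anti le_rfl (by omega)) ab.symm (by omega)
  have wx₁ : FarApart (G ⊔ edge z b) (k + 1) w x :=
    wx.sup_edge nzw.symm (wb.anti le_rfl (by omega)) zx (bx.anti le_rfl (by omega)) (by omega)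
  have wy₁ : FarApart (G ⊔ edge z b) (k + 1) w y :=
    wy.sup_edge nzw.symm (wb.anti le_rfl (by omega)) zy (yb.symm.anti le_rfl (by omega))
      (by omega)
  obtain ⟨s₂, e₂⟩ := s₁.exists_sup_edge
    (add₂.sup_edge (ne zx).symm (ne bx).symm (ne zy).symm (ne yb)) xy₁
  have wa₂ : FarApart (G ⊔ edge z b ⊔ edge x y) (k + 2) w a :=
    wa₁.sup_edge wx₁ wy₁ xa₁ ya₁ (by omega)
  obtain ⟨s₃, e₃⟩ := s₂.exists_sup_edge
    ((add₃.sup_edge (ne nzw).symm (ne wb) (ne za).symm (ne ab)).sup_edge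
      (ne wx) (ne wy) (ne xa).symm (ne ay)) wa₂
  exact ⟨_, s₃, by omega⟩

theorem IsPCSystem.even_length_iff {H : SimpleGraph V} {u v : V} (hH : IsPCSystem s c t H)
    (p : H.Walk u v) :
    Even p.length ↔ s u = s v := by
  induction p with
  | nil => simp
  | @cons x y z h p ih =>
    have := hH.bip _ _ h
    rw [Walk.length_cons, Nat.even_add_one, ih]
    revert this
    cases s x <;> cases s y <;> cases s z <;> decide

theorem IsPCSystem.card_le_two {H : SimpleGraph V} (hH : IsPCSystem s c t H) {x : V}
    {E : Finset V} (hE : ∀ b ∈ E, H.Adj x b) : E.card ≤ 2 := by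
  by_contra! h
  obtain ⟨a, b, d, ha, hb, hd, hab, had, hbd⟩ := Finset.two_lt_card_iff.1 h
  have := hH.deg x a b d (hE a ha) (hE b hb) (hE d hd)
  tauto

section Sphere

open scoped Classical in
/-- The vertices at distance exactly `r` from `v`. -/
noncomputable def sphere [Fintype V] (G : SimpleGraph V) (r : ℕ) (v : V) : Finset V :=
  {u | FarApart G r v u ∧ ∃ p : G.Walk v u, p.length = r}

variable [Fintype V] {G H : SimpleGraph V} {u v w z : V} {r : ℕ}

theorem mem_sphere : u ∈ sphere G r v ↔ FarApart G r v u ∧ ∃ p : G.Walk v u, p.length = r := by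
  simp [sphere]

theorem adj_of_mem_sphere_one (h : u ∈ sphere G 1 v) : G.Adj v u := by
  obtain ⟨-, p, hp⟩ := mem_sphere.1 h
  exact Walk.adj_of_length_eq_one hp

theorem exists_adj_of_mem_sphere_succ (h : u ∈ sphere G (r + 1) v) :
    ∃ w ∈ sphere G r v, G.Adj u w := by
  obtain ⟨hf, p, hp⟩ := mem_sphere.1 h
  have hp' : p.reverse.length = r + 1 := by rwa [Walk.length_reverse]
  generalize p.reverse = q at hp'
  cases q with
  | nil => simp at hp'
  | cons h q =>
    exact ⟨_, mem_sphere.2 ⟨hf.of_adj h, q.reverse, by simpa using hp'⟩, h⟩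

theorem disjoint_sphere_of_mem {r' : ℕ} (h : u ∈ sphere G r v) (h' : u ∈ sphere G r' v) :
    r = r' := by
  obtain ⟨hf, p, hp⟩ := mem_sphere.1 h
  obtain ⟨hf', p', hp'⟩ := mem_sphere.1 h'
  have := hf p'
  have := hf' p
  omega

theorem exists_mem_sphere_of_not_farApart {m : ℕ} (h : ¬FarApart G m v u) :
    ∃ r < m, u ∈ sphere G r v := by
  classical
  simp only [FarApart, not_forall, not_le] at h
  obtain ⟨p, hp⟩ := h
  have hex : ∃ r, ∃ p : G.Walk v u, p.length = r := ⟨_, p, rfl⟩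
  refine ⟨Nat.find hex, (Nat.find_min' hex ⟨p, rfl⟩).trans_lt hp,
    mem_sphere.2 ⟨fun q => Nat.find_min' hex ⟨q, rfl⟩, Nat.find_spec hex⟩⟩

theorem IsPCSystem.even_of_mem_sphere (hH : IsPCSystem s c t H) (h : u ∈ sphere H r v) :
    Even r ↔ s v = s u := by
  obtain ⟨-, p, rfl⟩ := mem_sphere.1 h
  exact hH.even_length_iff p

theorem card_sphere_zero_le : (sphere G 0 v).card ≤ 1 := by
  rw [Finset.card_le_one]
  intro a ha b hb
  obtain ⟨-, p, hp⟩ := mem_sphere.1 ha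
  obtain ⟨-, q, hq⟩ := mem_sphere.1 hb
  rw [← Walk.eq_of_length_eq_zero hp, Walk.eq_of_length_eq_zero hq]

theorem Deficient.card_sphere_one_le (hv : Deficient G v) : (sphere G 1 v).card ≤ 1 :=
  Finset.card_le_one.2 fun _ ha _ hb =>
    hv _ _ (adj_of_mem_sphere_one ha) (adj_of_mem_sphere_one hb)

theorem IsPCSystem.card_sphere_one_le (hH : IsPCSystem s c t H) : (sphere H 1 v).card ≤ 2 :=
  hH.card_le_two fun _ => adj_of_mem_sphere_one

theorem IsPCSystem.card_sphere_succ_le (hH : IsPCSystem s c t H) (r : ℕ) :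
    (sphere H (r + 2) v).card ≤ (sphere H (r + 1) v).card := by
  refine Finset.card_le_card_of_forall_subsingleton H.Adj
    (fun a ha => exists_adj_of_mem_sphere_succ ha) fun b hb a ha a' ha' => ?_
  obtain ⟨d, hd, hbd⟩ := exists_adj_of_mem_sphere_succ hb
  have had : a ≠ d := by
    rintro rfl
    have := disjoint_sphere_of_mem hd ha.1
    omega
  have had' : a' ≠ d := by
    rintro rfl
    have := disjoint_sphere_of_mem hd ha'.1
    omega
  have := hH.deg b a a' d ha.2.symm ha'.2.symm hbd
  tauto

theorem IsPCSystem.card_sphere_le (hH : IsPCSystem s c t H) (r : ℕ) :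
    (sphere H (r + 1) v).card ≤ (sphere H 1 v).card := by
  induction r with
  | zero => rfl
  | succ r ih => exact (hH.card_sphere_succ_le r).trans ih

theorem IsPCSystem.card_sphere_le_one (hH : IsPCSystem s c t H) (hv : Deficient H v) (r : ℕ) :
    (sphere H r v).card ≤ 1 := by
  cases r with
  | zero => exact card_sphere_zero_le
  | succ r => exact (hH.card_sphere_le r).trans hv.card_sphere_one_le

open scoped Classical in
theorem IsPCSystem.card_near_le (hH : IsPCSystem s c t H) (x : V) :
    ({y | s x ≠ s y ∧ ¬FarApart H t x y} : Finset V).card ≤ t := by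
  have hsub : ({y | s x ≠ s y ∧ ¬FarApart H t x y} : Finset V) ⊆
      (Finset.range (t / 2)).biUnion fun j => sphere H (2 * j + 1) x := by
    intro y hy
    simp only [Finset.mem_filter, Finset.mem_univ, true_and] at hy
    obtain ⟨r, hr, hy'⟩ := exists_mem_sphere_of_not_farApart hy.2
    have hodd : Odd r := by
      rw [← Nat.not_even_iff_odd, hH.even_of_mem_sphere hy']
      exact hy.1
    obtain ⟨j, rfl⟩ := hodd
    exact Finset.mem_biUnion.2 ⟨j, Finset.mem_range.2 (by omega), hy'⟩
  have := (Finset.card_le_card hsub).trans (Finset.card_biUnion_le_card_mul _ _ 2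
    fun j _ => (hH.card_sphere_le _).trans hH.card_sphere_one_le)
  rw [Finset.card_range] at this
  omega

open scoped Classical in
theorem IsPCSystem.card_near_deficient_le (hH : IsPCSystem s c t H) (ht : 3 ≤ t)
    (hz : Deficient H z) (hw : Deficient H w) (hzw : s z ≠ s w) :
    ({b | s z ≠ s b ∧ ¬H.Adj z b ∧ ¬(FarApart H (t - 1) z b ∧ FarApart H (t - 1) w b)} :
      Finset V).card ≤ t - 2 := by
  have hsub : ({b | s z ≠ s b ∧ ¬H.Adj z b ∧
      ¬(FarApart H (t - 1) z b ∧ FarApart H (t - 1) w b)} : Finset V) ⊆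
      ((Finset.Ico 1 ((t - 1) / 2)).biUnion fun j => sphere H (2 * j + 1) z) ∪
        (Finset.range (t / 2)).biUnion fun j => sphere H (2 * j) w := by
    intro b hb
    simp only [Finset.mem_filter, Finset.mem_univ, true_and, not_and_or] at hb
    obtain ⟨hs, hadj, hb⟩ := hb
    rw [Finset.mem_union, Finset.mem_biUnion, Finset.mem_biUnion]
    rcases hb with hb | hb
    · left
      obtain ⟨r, hr, hb'⟩ := exists_mem_sphere_of_not_farApart hb
      have hodd : Odd r := by
        rw [← Nat.not_even_iff_odd, hH.even_of_mem_sphere hb']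
        exact hs
      obtain ⟨j, rfl⟩ := hodd
      refine ⟨j, Finset.mem_Ico.2 ⟨?_, by omega⟩, hb'⟩
      rw [Nat.one_le_iff_ne_zero]
      rintro rfl
      exact hadj (adj_of_mem_sphere_one hb')
    · right
      obtain ⟨r, hr, hb'⟩ := exists_mem_sphere_of_not_farApart hb
      have heven : Even r := by
        rw [hH.even_of_mem_sphere hb']
        revert hs hzw
        cases s z <;> cases s w <;> cases s b <;> decide
      obtain ⟨j, rfl⟩ := heven.exists_two_nsmul
      exact ⟨j, Finset.mem_range.2 (by simp at hr; omega), by simpa using hb'⟩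
  have h₁ := Finset.card_biUnion_le_card_mul (Finset.Ico 1 ((t - 1) / 2))
    (fun j => sphere H (2 * j + 1) z) 1 fun j _ => hH.card_sphere_le_one hz _
  have h₂ := Finset.card_biUnion_le_card_mul (Finset.range (t / 2))
    (fun j => sphere H (2 * j) w) 1 fun j _ => hH.card_sphere_le_one hw _
  have h₃ := (Finset.card_le_card hsub).trans (Finset.card_union_le _ _)
  rw [Nat.card_Ico] at h₁
  rw [Finset.card_range] at h₂
  omega

end Sphere

open scoped Classical in
theorem Finset.card_mul_card_le_of_cover {X Y : Finset V} {N₁ N₂ N₃ : V → Finset V}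
    {f g : V → ℕ} {m : ℕ} (hN : ∀ x ∈ X, ∀ y ∈ Y, y ∈ N₁ x ∨ x ∈ N₂ y ∨ y ∈ N₃ x)
    (h₁ : ∀ x ∈ X, (N₁ x).card ≤ f x) (h₂ : ∀ y ∈ Y, (N₂ y).card ≤ g y)
    (h₃ : ∀ x ∈ X, (N₃ x).card ≤ m) :
    X.card * Y.card ≤ ∑ x ∈ X, f x + ∑ y ∈ Y, g y + X.card * m := by
  have h : ∀ x ∈ X, Y.card ≤ f x + (Y.filter fun y => x ∈ N₂ y).card + m := by
    intro x hx
    have hsub : Y ⊆ (N₁ x ∪ Y.filter fun y => x ∈ N₂ y) ∪ N₃ x := by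
      intro y hy
      have := hN x hx y hy
      simp only [Finset.mem_union, Finset.mem_filter]
      tauto
    have := Finset.card_le_card hsub
    have := Finset.card_union_le (N₁ x ∪ Y.filter fun y => x ∈ N₂ y) (N₃ x)
    have := Finset.card_union_le (N₁ x) (Y.filter fun y => x ∈ N₂ y)
    have := h₁ x hx
    have := h₃ x hx
    omega
  have hsum := Finset.sum_le_sum h
  rw [Finset.sum_const, smul_eq_mul, Finset.sum_add_distrib, Finset.sum_add_distrib,
    Finset.sum_const, smul_eq_mul] at hsum
  have e : ∑ x ∈ X, (Y.filter fun y => x ∈ N₂ y).card =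
      ∑ y ∈ Y, (X.filter fun x => x ∈ N₂ y).card :=
    Finset.sum_card_bipartiteAbove_eq_sum_card_bipartiteBelow fun x y => x ∈ N₂ y
  have i₂ : ∑ y ∈ Y, (X.filter fun x => x ∈ N₂ y).card ≤ ∑ y ∈ Y, g y :=
    Finset.sum_le_sum fun y hy => (Finset.card_le_card fun x hx =>
      (Finset.mem_filter.1 hx).2).trans (h₂ y hy)
  omega

section Counting

open scoped Classical

variable [Fintype V] {H : SimpleGraph V} {n D : ℕ}

theorem card_color_add (hcard : ∀ v, ({u | s v ≠ s u} : Finset V).card = n) (v : V) (γ : ℕ) :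
    ({u | s v ≠ s u ∧ c v u = γ} : Finset V).card +
      ({u | s v ≠ s u ∧ c v u ≠ γ} : Finset V).card = n := by
  rw [← hcard v, ← Finset.filter_filter, ← Finset.filter_filter]
  exact Finset.card_filter_add_card_filter_not _

theorem le_card_color_ne_add_one
    (hcol : ∀ v, D ≤ (({u | s v ≠ s u} : Finset V).image (c v)).card) (v : V) (γ : ℕ) :
    D ≤ ({u | s v ≠ s u ∧ c v u ≠ γ} : Finset V).card + 1 := by
  have hsub : ({u | s v ≠ s u} : Finset V).image (c v) ⊆
      insert γ (({u | s v ≠ s u ∧ c v u ≠ γ} : Finset V).image (c v)) := by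
    intro x hx
    simp only [Finset.mem_image, Finset.mem_insert, Finset.mem_filter, Finset.mem_univ,
      true_and] at hx ⊢
    obtain ⟨u, hu, rfl⟩ := hx
    by_cases h : c v u = γ
    exacts [Or.inl h, Or.inr ⟨u, ⟨hu, h⟩, rfl⟩]
  calc D ≤ _ := hcol v
    _ ≤ _ := Finset.card_le_card hsub
    _ ≤ _ := Finset.card_insert_le _ _
    _ ≤ _ := Nat.add_le_add_right Finset.card_image_le 1

theorem IsPCSystem.exists_exchange (hH : IsPCSystem s c t H)
    (hmax : ∀ H', IsPCSystem s c t H' → H'.edgeSet.ncard ≤ H.edgeSet.ncard) {z w b : V}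
    (hz : Deficient H z) (hs : s z ≠ s b) (hb : ∀ u, H.Adj z u → c z b ≠ c z u)
    (hzb : FarApart H (t - 1) z b) (hwb : FarApart H (t - 1) w b) :
    ∃ x, Exchange s c t H z w b x := by
  by_cases hx : ∃ x, H.Adj b x ∧ ∀ u, H.Adj b u → u ≠ x → c b z ≠ c b u
  · obtain ⟨x, hbx, hx⟩ := hx
    exact ⟨x, hs, hb, hzb, hwb, hbx, hx⟩
  · exfalso
    push Not at hx
    by_cases h₁ : ∃ x, H.Adj b x
    · obtain ⟨x, hbx⟩ := h₁
      obtain ⟨y, hby, hyx, hy⟩ := hx x hbx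
      obtain ⟨x', hbx', hxy', hx'⟩ := hx y hby
      have := hH.pc b x' y hbx' hby hxy'
      exact this (hx'.symm.trans hy)
    · push Not at h₁
      have hadd : Addable s c H z b :=
        ⟨hs, hz, fun x _ h => absurd h (h₁ x), hb, fun x h => absurd h (h₁ x)⟩
      obtain ⟨h', e⟩ := hH.exists_sup_edge hadd hzb
      have := hmax _ h'
      omega

/-- The vertices `b` for which `zb` can replace the edge `bx`. -/
noncomputable def exchangeStarts (s : V → Bool) (c : V → V → ℕ) (t : ℕ) (H : SimpleGraph V)
    (z w x : V) : Finset V :=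
  {b | Exchange s c t H z w b x}

/-- The vertices `x` for which an edge `zb` can replace some edge `bx`. -/
noncomputable def exchangeEnds (s : V → Bool) (c : V → V → ℕ) (t : ℕ) (H : SimpleGraph V)
    (z w : V) : Finset V :=
  {x | ∃ b, Exchange s c t H z w b x}

theorem mem_exchangeStarts {z w x b : V} :
    b ∈ exchangeStarts s c t H z w x ↔ Exchange s c t H z w b x := by
  simp [exchangeStarts]

theorem mem_exchangeEnds {z w x : V} :
    x ∈ exchangeEnds s c t H z w ↔ ∃ b, Exchange s c t H z w b x := by
  simp [exchangeEnds]

theorem IsPCSystem.le_sum_card_exchange (hH : IsPCSystem s c t H) (ht : 3 ≤ t)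
    (hmax : ∀ H', IsPCSystem s c t H' → H'.edgeSet.ncard ≤ H.edgeSet.ncard)
    (hcol : ∀ v, D ≤ (({u | s v ≠ s u} : Finset V).image (c v)).card) {z w : V}
    (hz : Deficient H z) (hw : Deficient H w) (hzw : s z ≠ s w) :
    D + 1 ≤ ∑ x ∈ exchangeEnds s c t H z w, (exchangeStarts s c t H z w x).card + t := by
  obtain ⟨γ, hγ⟩ : ∃ γ, ∀ u, H.Adj z u → c z u = γ := by
    by_cases h : ∃ u, H.Adj z u
    · obtain ⟨u, hu⟩ := h
      exact ⟨c z u, fun v hv => by rw [hz v u hv hu]⟩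
    · exact ⟨0, fun u hu => absurd ⟨u, hu⟩ h⟩
  have hsub : ({b | s z ≠ s b ∧ c z b ≠ γ} : Finset V) ⊆
      ({b | s z ≠ s b ∧ ¬H.Adj z b ∧ ¬(FarApart H (t - 1) z b ∧ FarApart H (t - 1) w b)} :
        Finset V) ∪
      (exchangeEnds s c t H z w).biUnion (exchangeStarts s c t H z w) := by
    intro b hb
    simp only [Finset.mem_union, Finset.mem_biUnion, Finset.mem_filter, Finset.mem_univ,
      true_and, mem_exchangeEnds, mem_exchangeStarts] at hb ⊢
    obtain ⟨hs, hb⟩ := hb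
    by_cases hfar : FarApart H (t - 1) z b ∧ FarApart H (t - 1) w b
    · right
      obtain ⟨x, hx⟩ := hH.exists_exchange hmax hz hs (fun u hu => by rwa [hγ u hu])
        hfar.1 hfar.2
      exact ⟨x, ⟨b, hx⟩, hx⟩
    · exact Or.inl ⟨hs, fun h => hb (hγ b h), hfar⟩
  have h₁ := le_card_color_ne_add_one hcol z γ
  have h₂ := (Finset.card_le_card hsub).trans (Finset.card_union_le _ _)
  have h₃ := hH.card_near_deficient_le ht hz hw hzw
  have h₄ := Finset.card_biUnion_le (s := exchangeEnds s c t H z w)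
    (t := exchangeStarts s c t H z w)
  omega

theorem IsPCSystem.card_blocked_le (hH : IsPCSystem s c t H) (ht : 3 ≤ t)
    (hcard : ∀ v, ({u | s v ≠ s u} : Finset V).card = n)
    (hcol : ∀ v, D ≤ (({u | s v ≠ s u} : Finset V).image (c v)).card) {x : V} {E : Finset V}
    (hE : ∀ b ∈ E, H.Adj x b) (hne : E.Nonempty) :
    ({y | s x ≠ s y ∧ FarApart H t x y ∧ ∀ b ∈ E, ∃ b', H.Adj x b' ∧ b' ≠ b ∧ c x y = c x b'} :
      Finset V).card ≤ (n - D) * (2 - E.card) := by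
  obtain ⟨b, hb⟩ := hne
  by_cases hb' : ∃ b', H.Adj x b' ∧ b' ≠ b
  · obtain ⟨b', hxb', hbb'⟩ := hb'
    have hnbr : ∀ u, H.Adj x u → u = b ∨ u = b' := fun u hu => by
      have := hH.deg x u b b' hu (hE b hb) hxb'
      tauto
    by_cases hE₁ : E = {b}
    · subst hE₁
      have hsub : ({y | s x ≠ s y ∧ FarApart H t x y ∧
          ∀ d ∈ ({b} : Finset V), ∃ b', H.Adj x b' ∧ b' ≠ d ∧ c x y = c x b'} : Finset V) ⊆
          ({u | s x ≠ s u ∧ c x u = c x b'} : Finset V).erase b' := by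
        intro y hy
        simp only [Finset.mem_filter, Finset.mem_univ, true_and, Finset.mem_singleton,
          forall_eq, Finset.mem_erase] at hy ⊢
        obtain ⟨hs, hf, d, hd, hdb, hc⟩ := hy
        obtain rfl : d = b' := (hnbr d hd).resolve_left hdb
        refine ⟨?_, hs, hc⟩
        rintro rfl
        have := hf hd.toWalk
        simp at this
        omega
      have h₁ := Finset.card_le_card hsub
      rw [Finset.card_erase_of_mem (by simpa using hH.bip _ _ hxb')] at h₁
      have h₂ := card_color_add (c := c) hcard x (c x b')
      have h₃ := le_card_color_ne_add_one hcol x (c x b')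
      rw [Finset.card_singleton, show 2 - 1 = 1 from rfl, mul_one]
      omega
    · obtain ⟨d, hd, hdb⟩ : ∃ d ∈ E, d ≠ b := by
        by_contra! h
        exact hE₁ (Finset.eq_singleton_iff_unique_mem.2 ⟨hb, h⟩)
      obtain rfl : d = b' := (hnbr d (hE d hd)).resolve_left hdb
      rw [Finset.card_eq_zero.2 (Finset.filter_eq_empty_iff.2 ?_)]
      · exact Nat.zero_le _
      rintro y - ⟨-, -, h⟩
      obtain ⟨u, hu, hub, h₁⟩ := h b hb
      obtain ⟨v, hv, hvd, h₂⟩ := h d hd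
      obtain rfl := (hnbr u hu).resolve_left hub
      obtain rfl := (hnbr v hv).resolve_right hvd
      exact hH.pc x _ _ hu hv hub (h₁.symm.trans h₂)
  · rw [Finset.card_eq_zero.2 (Finset.filter_eq_empty_iff.2 ?_)]
    · exact Nat.zero_le _
    rintro y - ⟨-, -, h⟩
    obtain ⟨b', h₁, h₂, -⟩ := h b hb
    exact hb' ⟨b', h₁, h₂⟩

end Counting

theorem false_of_exchange_count {P Q P₁ Q₁ B M t : ℤ} (hB : 0 ≤ B) (ht : 0 ≤ t)
    (hQP : Q ≤ P) (h : P * Q ≤ B * P₁ + B * Q₁ + Q * t) (hP : P₁ ≤ P) (hP' : P₁ + M ≤ 2 * P)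
    (hQ : Q₁ ≤ Q) (hQ' : Q₁ + M ≤ 2 * Q) (hP₁ : 0 ≤ P₁) (hQ₁ : 0 ≤ Q₁)
    (hM : 2 * B + 2 * t + 1 ≤ M) : False := by
  rcases le_or_gt M P with hMP | hMP
  · have h₁ : B * P₁ ≤ B * P := mul_le_mul_of_nonneg_left hP hB
    rcases le_or_gt M Q with hMQ | hMQ
    · have h₂ : B * Q₁ ≤ B * P := mul_le_mul_of_nonneg_left (hQ.trans hQP) hB
      have h₃ : Q * t ≤ P * t := mul_le_mul_of_nonneg_right hQP ht
      have h₄ : 0 < P * (Q - 2 * B - t) := mul_pos (by linarith) (by linarith)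
      linarith
    · have h₂ : B * Q₁ ≤ B * (2 * Q - M) := mul_le_mul_of_nonneg_left (by linarith) hB
      have h₃ : M * (Q - B) ≤ P * (Q - B) := mul_le_mul_of_nonneg_right hMP (by linarith)
      have h₄ : 0 < (M - 2 * B - t) * Q := mul_pos (by linarith) (by linarith)
      linarith
  · have h₁ : B * (P₁ + Q₁) ≤ B * (2 * P + 2 * Q - 2 * M) :=
      mul_le_mul_of_nonneg_left (by linarith) hB
    have h₂ : 2 * B * (P + Q - M) ≤ (M - 2 * t - 1) * (P + Q - M) :=
      mul_le_mul_of_nonneg_right (by linarith) (by linarith)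
    have ha : 1 ≤ M - P := by linarith
    have h₃ : (M - P) * (M - Q) + (2 * t + 1) * (P + Q - M) ≤ Q * t := by linarith
    rcases le_or_gt (M - Q) t with hb | hb
    · have h₄ : 0 < (2 * t + 1 - (M - Q)) * (t + 1 - (M - P)) :=
        mul_pos (by linarith) (by linarith)
      have h₅ : 0 ≤ (t + 1) * (M - 2 * t - 1) := mul_nonneg (by linarith) (by linarith)
      linarith
    · have h₄ : 0 < (M - P) * (M - Q - t) := mul_pos (by linarith) (by linarith)
      have h₅ : 0 ≤ (t + 1) * (2 * Q - M) := mul_nonneg (by linarith) (by linarith)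
      have h₆ : 0 ≤ (t + 1) * (P - Q) := mul_nonneg (by linarith) (by linarith)
      linarith

theorem Exchange.side_right {H : SimpleGraph V} (hH : IsPCSystem s c t H) {z w b x : V}
    (h : Exchange s c t H z w b x) : s x = s z := by
  have h₁ := h.side
  have h₂ := hH.bip _ _ h.adj
  revert h₁ h₂
  cases s z <;> cases s b <;> cases s x <;> decide

section Core

variable [Fintype V] {H : SimpleGraph V} {n D : ℕ}

theorem exchangeStarts_nonempty {z w x : V} (hx : x ∈ exchangeEnds s c t H z w) :
    (exchangeStarts s c t H z w x).Nonempty := by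
  obtain ⟨b, hb⟩ := mem_exchangeEnds.1 hx
  exact ⟨b, mem_exchangeStarts.2 hb⟩

theorem adj_of_mem_exchangeStarts {z w x b : V} (hb : b ∈ exchangeStarts s c t H z w x) :
    H.Adj x b :=
  (mem_exchangeStarts.1 hb).adj.symm

open scoped Classical in
theorem IsPCSystem.card_exchangeEnds_mul_le (hH : IsPCSystem s c t H) (ht : 3 ≤ t)
    (hmax : ∀ H', IsPCSystem s c t H' → H'.edgeSet.ncard ≤ H.edgeSet.ncard)
    (hcard : ∀ v, ({u | s v ≠ s u} : Finset V).card = n)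
    (hcol : ∀ v, D ≤ (({u | s v ≠ s u} : Finset V).image (c v)).card) {z w : V}
    (hz : Deficient H z) (hw : Deficient H w) (hzw : s z ≠ s w) :
    (exchangeEnds s c t H z w).card * (exchangeEnds s c t H w z).card ≤
      ∑ x ∈ exchangeEnds s c t H z w, (n - D) * (2 - (exchangeStarts s c t H z w x).card) +
      ∑ y ∈ exchangeEnds s c t H w z, (n - D) * (2 - (exchangeStarts s c t H w z y).card) +
      (exchangeEnds s c t H z w).card * t := by
  refine Finset.card_mul_card_le_of_cover
    (N₁ := fun x => {y | s x ≠ s y ∧ FarApart H t x y ∧ ∀ b ∈ exchangeStarts s c t H z w x,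
      ∃ b', H.Adj x b' ∧ b' ≠ b ∧ c x y = c x b'})
    (N₂ := fun y => {x | s y ≠ s x ∧ FarApart H t y x ∧ ∀ a ∈ exchangeStarts s c t H w z y,
      ∃ a', H.Adj y a' ∧ a' ≠ a ∧ c y x = c y a'})
    (N₃ := fun x => {y | s x ≠ s y ∧ ¬FarApart H t x y})
    (fun x hx y hy => ?_)
    (fun x hx => hH.card_blocked_le ht hcard hcol (fun b => adj_of_mem_exchangeStarts)
      (exchangeStarts_nonempty hx))
    (fun y hy => hH.card_blocked_le ht hcard hcol (fun b => adj_of_mem_exchangeStarts)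
      (exchangeStarts_nonempty hy))
    (fun x _ => hH.card_near_le x)
  obtain ⟨b₀, hb₀⟩ := mem_exchangeEnds.1 hx
  obtain ⟨a₀, ha₀⟩ := mem_exchangeEnds.1 hy
  have hxy : s x ≠ s y := by rwa [hb₀.side_right hH, ha₀.side_right hH]
  simp only [Finset.mem_filter, Finset.mem_univ, true_and]
  by_contra! h
  obtain ⟨h₁, h₂, h₃⟩ := h
  obtain ⟨b, hb, hb'⟩ := h₁ hxy (h₃ hxy)
  obtain ⟨a, ha, ha'⟩ := h₂ hxy.symm (h₃ hxy).symm
  obtain ⟨H', hH', hlt⟩ := hH.exists_larger ht hz hw hzw (mem_exchangeStarts.1 hb)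
    (mem_exchangeStarts.1 ha) (h₃ hxy) hb' ha'
  exact absurd (hmax H' hH') (by omega)

theorem IsPCSystem.sum_two_sub_card_exchangeStarts (hH : IsPCSystem s c t H) (z w : V) :
    ∑ x ∈ exchangeEnds s c t H z w, (2 - (exchangeStarts s c t H z w x).card) ≤
        (exchangeEnds s c t H z w).card ∧
      ∑ x ∈ exchangeEnds s c t H z w, (2 - (exchangeStarts s c t H z w x).card) +
        ∑ x ∈ exchangeEnds s c t H z w, (exchangeStarts s c t H z w x).card =
        2 * (exchangeEnds s c t H z w).card := by
  constructor
  · rw [Finset.card_eq_sum_ones]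
    refine Finset.sum_le_sum fun x hx => ?_
    have := (exchangeStarts_nonempty hx).card_pos
    omega
  · rw [← Finset.sum_add_distrib, mul_comm, ← smul_eq_mul, ← Finset.sum_const]
    refine Finset.sum_congr rfl fun x hx => ?_
    have := hH.card_le_two fun b => adj_of_mem_exchangeStarts (s := s) (c := c) (t := t)
      (H := H) (z := z) (w := w) (x := x) (b := b)
    omega

open scoped Classical in
theorem IsPCSystem.card_exchangeEnds_lt (hH : IsPCSystem s c t H) (ht : 3 ≤ t)
    (hmax : ∀ H', IsPCSystem s c t H' → H'.edgeSet.ncard ≤ H.edgeSet.ncard)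
    (hcard : ∀ v, ({u | s v ≠ s u} : Finset V).card = n)
    (hcol : ∀ v, D ≤ (({u | s v ≠ s u} : Finset V).image (c v)).card)
    (hD : 2 * n + 3 * t ≤ 3 * D) (hDn : D ≤ n) {z w : V}
    (hz : Deficient H z) (hw : Deficient H w) (hzw : s z ≠ s w) :
    (exchangeEnds s c t H w z).card < (exchangeEnds s c t H z w).card := by
  by_contra! hle
  have h₁ := hH.card_exchangeEnds_mul_le ht hmax hcard hcol hz hw hzw
  have h₂ := hH.le_sum_card_exchange ht hmax hcol hz hw hzw
  have h₃ := hH.le_sum_card_exchange ht hmax hcol hw hz hzw.symm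
  obtain ⟨h₄, h₅⟩ := hH.sum_two_sub_card_exchangeStarts z w
  obtain ⟨h₆, h₇⟩ := hH.sum_two_sub_card_exchangeStarts w z
  rw [← Finset.mul_sum, ← Finset.mul_sum] at h₁
  generalize (exchangeEnds s c t H z w).card = Q at *
  generalize (exchangeEnds s c t H w z).card = P at *
  generalize ∑ x ∈ exchangeEnds s c t H z w, (2 - (exchangeStarts s c t H z w x).card) = Q₁ at *
  generalize ∑ x ∈ exchangeEnds s c t H w z, (2 - (exchangeStarts s c t H w z x).card) = P₁ at *
  obtain ⟨B, rfl⟩ := Nat.exists_eq_add_of_le hDn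
  rw [Nat.add_sub_cancel_left] at h₁
  zify at h₁ h₄ h₆ hle
  refine false_of_exchange_count (P := P) (Q := Q) (P₁ := P₁) (Q₁ := Q₁) (B := B)
    (M := (D : ℤ) + 1 - t) (t := t) (by positivity) (by positivity) hle ?_ h₆ ?_ h₄ ?_
    (by positivity) (by positivity) ?_
  · linarith
  all_goals omega

open scoped Classical in
theorem IsPCSystem.not_deficient_of_maximal (hH : IsPCSystem s c t H) (ht : 3 ≤ t)
    (hmax : ∀ H', IsPCSystem s c t H' → H'.edgeSet.ncard ≤ H.edgeSet.ncard)
    (hcard : ∀ v, ({u | s v ≠ s u} : Finset V).card = n)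
    (hcol : ∀ v, D ≤ (({u | s v ≠ s u} : Finset V).image (c v)).card)
    (hD : 2 * n + 3 * t ≤ 3 * D) {z w : V} (hz : Deficient H z) (hzw : s z ≠ s w) :
    ¬Deficient H w := by
  intro hw
  have hDn : D ≤ n := (hcol z).trans (Finset.card_image_le.trans (hcard z).le)
  have h₁ := hH.card_exchangeEnds_lt ht hmax hcard hcol hD hDn hz hw hzw
  have h₂ := hH.card_exchangeEnds_lt ht hmax hcard hcol hD hDn hw hz hzw.symm
  omega

open scoped Classical in
theorem deficient_iff {v : V} : Deficient H v ↔ H.degree v ≤ 1 := by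
  rw [← card_neighborFinset_eq_degree, Finset.card_le_one]
  simp only [mem_neighborFinset, Deficient]
  exact ⟨fun h a ha b hb => h a b ha hb, fun h a b ha hb => h a ha b hb⟩

open scoped Classical in
theorem IsPCSystem.degree_le_two (hH : IsPCSystem s c t H) (v : V) : H.degree v ≤ 2 := by
  rw [← card_neighborFinset_eq_degree]
  exact hH.card_le_two fun b hb => by simpa using hb

open scoped Classical in
theorem IsPCSystem.exists_deficient (hH : IsPCSystem s c t H)
    (hcard : ∀ v, ({u | s v ≠ s u} : Finset V).card = n) (hn : 0 < n) {z : V} (hz : Deficient H z) :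
    ∃ w, s z ≠ s w ∧ Deficient H w := by
  by_contra! hw
  have hbip : H.IsBipartiteWith (({u | s z ≠ s u} : Finset V) : Set V)
      (({u | s z = s u} : Finset V) : Set V) := by
    refine ⟨?_, fun u v huv => ?_⟩
    · rw [Finset.disjoint_coe, Finset.disjoint_filter]
      exact fun _ _ => id
    · have := hH.bip _ _ huv
      simp only [Finset.coe_filter, Finset.mem_univ, true_and, Set.mem_ofPred_eq]
      revert this
      cases s u <;> cases s v <;> cases s z <;> decide
  have hsum := isBipartiteWith_sum_degrees_eq hbip
  have h₁ : ∑ u ∈ ({u | s z ≠ s u} : Finset V), 2 ≤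
      ∑ u ∈ ({u | s z ≠ s u} : Finset V), H.degree u :=
    Finset.sum_le_sum fun u hu => by
      have := hw u (Finset.mem_filter.1 hu).2
      rw [deficient_iff] at this
      omega
  have h₂ : ∑ u ∈ ({u | s z = s u} : Finset V), H.degree u <
      ∑ u ∈ ({u | s z = s u} : Finset V), 2 := by
    refine Finset.sum_lt_sum (fun u _ => hH.degree_le_two u) ⟨z, by simp, ?_⟩
    have := deficient_iff.1 hz
    omega
  obtain ⟨w, hzw⟩ := Finset.card_pos.1 (hn.trans_eq (hcard z).symm)
  have hzw := (Finset.mem_filter.1 hzw).2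
  have h₃ : ({u | s z = s u} : Finset V).card = n := by
    rw [← hcard w]
    congr 1
    ext u
    simp only [Finset.mem_filter, Finset.mem_univ, true_and]
    revert hzw
    cases s u <;> cases s w <;> cases s z <;> decide
  rw [Finset.sum_const, hcard] at h₁
  rw [Finset.sum_const, h₃] at h₂
  omega

open scoped Classical in
theorem exists_isPCSystem_two_regular (ht : 3 ≤ t)
    (hcard : ∀ v, ({u | s v ≠ s u} : Finset V).card = n)
    (hcol : ∀ v, D ≤ (({u | s v ≠ s u} : Finset V).image (c v)).card)
    (hD : 2 * n + 3 * t ≤ 3 * D) :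
    ∃ H, IsPCSystem s c t H ∧ ∀ v, ¬Deficient H v := by
  obtain ⟨H, hH, hmax⟩ := Set.exists_max_image {H | IsPCSystem s c t H}
    (fun H => H.edgeSet.ncard) (Set.toFinite _) ⟨⊥, isPCSystem_bot⟩
  refine ⟨H, hH, fun z hz => ?_⟩
  have hDn : D ≤ n := (hcol z).trans (Finset.card_image_le.trans (hcard z).le)
  obtain ⟨w, hzw, hw⟩ := hH.exists_deficient hcard (by omega) hz
  exact hH.not_deficient_of_maximal ht hmax hcard hcol hD hz hzw hw

end Core

section Decomposition

variable {H : SimpleGraph V}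

theorem SimpleGraph.exists_isPath_maximal [Fintype V] (G : SimpleGraph V) (v : V) :
    ∃ (a b : V) (p : G.Walk a b), p.IsPath ∧ G.Reachable v a ∧
      ∀ (a' b' : V) (q : G.Walk a' b'), q.IsPath → G.Reachable v a' → q.length ≤ p.length := by
  obtain ⟨m, ⟨a, b, p, hp, ha, rfl⟩, hm⟩ := Set.exists_max_image
    {m | ∃ (a b : V) (p : G.Walk a b), p.IsPath ∧ G.Reachable v a ∧ p.length = m} id
    ((Set.finite_lt_nat (Fintype.card V)).subset (by
      rintro _ ⟨a, b, p, hp, -, rfl⟩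
      exact hp.length_lt))
    ⟨0, v, v, Walk.nil, Walk.IsPath.nil, Reachable.refl v, rfl⟩
  exact ⟨a, b, p, hp, ha, fun a' b' q hq ha' => hm _ ⟨a', b', q, hq, ha', rfl⟩⟩

theorem IsPCSystem.adj_ends_of_isPath (hH : IsPCSystem s c t H) {a b : V} {p : H.Walk a b}
    (hp : p.IsPath) (hb : ¬Deficient H b) (hmax : ∀ u, H.Adj b u → u ∈ p.support) :
    H.Adj a b ∧ 2 ≤ p.length := by
  simp only [Deficient, not_forall] at hb
  obtain ⟨x, y, hx, hy, hxy⟩ := hb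
  have key : ∀ u, H.Adj b u → ∃ i < p.length, p.getVert i = u ∧ (0 < i → i + 1 = p.length) := by
    intro u hu
    obtain ⟨i, rfl, hi⟩ := Walk.mem_support_iff_exists_getVert.1 (hmax u hu)
    have hib : i ≠ p.length := by
      rintro rfl
      rw [Walk.getVert_length] at hu
      exact hu.ne rfl
    refine ⟨i, by omega, rfl, fun hi₀ => ?_⟩
    obtain ⟨j, rfl⟩ : ∃ j, i = j + 1 := ⟨i - 1, by omega⟩
    by_contra hj
    have inj := hp.getVert_injOn
    rcases hH.deg (p.getVert (j + 1)) (p.getVert j) (p.getVert (j + 1 + 1)) (p.getVert p.length)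
      (p.adj_getVert_succ (by omega)).symm (p.adj_getVert_succ (by omega))
      (by rw [Walk.getVert_length]; exact hu.symm) with h | h | h
    · have := inj (by simp only [Set.mem_ofPred_eq]; omega)
        (by simp only [Set.mem_ofPred_eq]; omega) h
      omega
    · have := inj (by simp only [Set.mem_ofPred_eq]; omega)
        (by simp only [Set.mem_ofPred_eq]; omega) h
      omega
    · have := inj (by simp only [Set.mem_ofPred_eq]; omega)
        (by simp only [Set.mem_ofPred_eq]; omega) h
      omega
  obtain ⟨i, hi, rfl, hi'⟩ := key x hx
  obtain ⟨j, hj, rfl, hj'⟩ := key y hy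
  have hij : i ≠ j := by
    rintro rfl
    exact hxy rfl
  refine ⟨?_, by omega⟩
  rcases Nat.eq_zero_or_pos i with rfl | hi₀
  · rw [Walk.getVert_zero] at hx
    exact hx.symm
  · obtain rfl : j = 0 := by omega
    rw [Walk.getVert_zero] at hy
    exact hy.symm

theorem IsPCSystem.mem_support_of_adj (hH : IsPCSystem s c t H) {a b u v : V} {p : H.Walk a b}
    (hp : p.IsPath) (hab : H.Adj a b) (hl : 2 ≤ p.length) (hu : u ∈ p.support)
    (huv : H.Adj u v) : v ∈ p.support := by
  obtain ⟨i, rfl, hi⟩ := Walk.mem_support_iff_exists_getVert.1 hu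
  have inj := hp.getVert_injOn
  obtain ⟨j, k, hj, hk, hjk, hij, hik⟩ : ∃ j k, j ≤ p.length ∧ k ≤ p.length ∧ j ≠ k ∧
      H.Adj (p.getVert i) (p.getVert j) ∧ H.Adj (p.getVert i) (p.getVert k) := by
    rcases Nat.eq_zero_or_pos i with rfl | hi₀
    · refine ⟨1, p.length, by omega, le_rfl, by omega, p.adj_getVert_succ (by omega), ?_⟩
      rwa [Walk.getVert_zero, Walk.getVert_length]
    · obtain ⟨j, rfl⟩ : ∃ j, i = j + 1 := ⟨i - 1, by omega⟩
      rcases hi.eq_or_lt with he | hi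
      · refine ⟨j, 0, by omega, by omega, by omega, (p.adj_getVert_succ (by omega)).symm, ?_⟩
        rw [he, Walk.getVert_zero, Walk.getVert_length]
        exact hab.symm
      · exact ⟨j, j + 1 + 1, by omega, by omega, by omega,
          (p.adj_getVert_succ (by omega)).symm, p.adj_getVert_succ (by omega)⟩
  rcases hH.deg _ _ _ _ hij hik huv with h | h | h
  · exact absurd (inj hj hk h) hjk
  · exact h ▸ p.getVert_mem_support j
  · exact h ▸ p.getVert_mem_support k

/-- Every component of a properly colored system without deficient vertices has a Hamiltonian
path on an even number of vertices. -/
theorem IsPCSystem.exists_isPath_support [Fintype V] (hH : IsPCSystem s c t H)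
    (hdef : ∀ v, ¬Deficient H v) (v : V) :
    ∃ (a b : V) (p : H.Walk a b), p.IsPath ∧ t ≤ p.support.length ∧ Even p.support.length ∧
      ∀ u, u ∈ p.support ↔ H.Reachable v u := by
  classical
  obtain ⟨a, b, p, hp, ha, hmax⟩ := H.exists_isPath_maximal v
  have hb : ∀ u, H.Adj b u → u ∈ p.support := by
    intro u hu
    by_contra h
    have := hmax _ _ _ (hp.concat h hu) ha
    rw [Walk.length_concat] at this
    omega
  obtain ⟨hab, hl⟩ := hH.adj_ends_of_isPath hp (hdef b) hb
  refine ⟨a, b, p, hp, ?_, ?_, fun u => ⟨fun hu => ?_, fun hu => ?_⟩⟩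
  · have hmem : ∀ e ∈ p.edges, e ∈ (H.deleteEdges {s(a, b)}).edgeSet := by
      intro e he
      rw [edgeSet_deleteEdges]
      refine ⟨p.edges_subset_edgeSet he, ?_⟩
      rintro rfl
      have := hp.length_eq_one_of_mem_edges he
      omega
    have := hH.girth a b hab (p.transfer _ hmem)
    rw [Walk.length_transfer] at this
    rw [Walk.length_support]
    omega
  · rw [Walk.length_support, Nat.even_add_one, hH.even_length_iff]
    exact hH.bip _ _ hab
  · exact ha.trans (p.takeUntil u hu).reachable
  · obtain ⟨q⟩ := ha.symm.trans hu
    have : ∀ {x y : V} (q : H.Walk x y), x ∈ p.support → y ∈ p.support := by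
      intro x y q
      induction q with
      | nil => exact id
      | cons h q ih => exact fun hx => ih (hH.mem_support_of_adj hp hab hl hx h)
    exact this q p.start_mem_support

/-- A properly colored system without deficient vertices yields a partition of the vertices into
few paths. -/
theorem IsPCSystem.exists_path_partition [Fintype V] (hH : IsPCSystem s c t H)
    (hdef : ∀ v, ¬Deficient H v) :
    ∃ F : Finset (List V), F.card * t ≤ Fintype.card V ∧
      (∀ l ∈ F, ∃ (a b : V) (p : H.Walk a b), p.IsPath ∧ l = p.support ∧ Even l.length) ∧
      (∀ l ∈ F, ∀ l' ∈ F, l ≠ l' → ∀ v, v ∈ l → v ∉ l') ∧ ∀ v, ∃ l ∈ F, v ∈ l := by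
  classical
  choose a b p hp ht he hr using hH.exists_isPath_support hdef
  let f : H.ConnectedComponent → List V := fun C => (p C.out).support
  have hf : ∀ C v, v ∈ f C ↔ H.connectedComponentMk v = C := by
    intro C v
    have hC : H.connectedComponentMk C.out = C := Quot.out_eq C
    rw [hr, ← ConnectedComponent.eq, hC, eq_comm]
  refine ⟨Finset.univ.image f, ?_, ?_, ?_, fun v => ?_⟩
  · calc (Finset.univ.image f).card * t ≤ Fintype.card H.ConnectedComponent * t :=
          Nat.mul_le_mul_right _ Finset.card_image_le
      _ = ∑ C : H.ConnectedComponent, t := by simp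
      _ ≤ ∑ C : H.ConnectedComponent, (f C).toFinset.card := by
          refine Finset.sum_le_sum fun C _ => ?_
          rw [List.toFinset_card_of_nodup (hp _).support_nodup]
          exact ht _
      _ = (Finset.univ.biUnion fun C => (f C).toFinset).card := by
          refine (Finset.card_biUnion fun C _ C' _ hC => ?_).symm
          refine Finset.disjoint_left.2 fun v hv hv' => ?_
          rw [List.mem_toFinset, hf] at hv hv'
          exact hC (hv.symm.trans hv')
      _ ≤ Fintype.card V := Finset.card_le_univ _
  · simp only [Finset.mem_image, Finset.mem_univ, true_and, forall_exists_index,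
      forall_apply_eq_imp_iff]
    exact fun C => ⟨_, _, p C.out, hp _, rfl, he _⟩
  · simp only [Finset.mem_image, Finset.mem_univ, true_and, forall_exists_index,
      forall_apply_eq_imp_iff]
    intro C C' hC v hv hv'
    rw [hf] at hv hv'
    exact hC (by rw [← hv, hv'])
  · exact ⟨_, Finset.mem_image_of_mem f (Finset.mem_univ (H.connectedComponentMk v)),
      (hf _ _).2 rfl⟩

end Decomposition

end

theorem card_filter_isLeft_ne (n : ℕ) (v : V2 n) :
    (Finset.univ.filter fun u : V2 n => v.isLeft ≠ u.isLeft).card = n := by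
  rcases v with x | y
  · have : (Finset.univ.filter fun u : V2 n => (Sum.inl x : V2 n).isLeft ≠ u.isLeft) =
        Finset.univ.map (Function.Embedding.inr : Fin n ↪ V2 n) := by
      ext (u | u) <;> simp
    rw [this, Finset.card_map, Finset.card_fin]
  · have : (Finset.univ.filter fun u : V2 n => (Sum.inr y : V2 n).isLeft ≠ u.isLeft) =
        Finset.univ.map (Function.Embedding.inl : Fin n ↪ V2 n) := by
      ext (u | u) <;> simp
    rw [this, Finset.card_map, Finset.card_fin]

theorem colorDeg_le_card_image (n : ℕ) (c : V2 n → V2 n → ℕ) (v : V2 n) :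
    colorDeg n c v ≤
      ((Finset.univ.filter fun u : V2 n => v.isLeft ≠ u.isLeft).image (c v)).card := by
  rcases v with x | y
  all_goals
    refine Finset.card_le_card fun k hk => ?_
    simp only [Finset.mem_image, Finset.mem_univ, true_and] at hk
    obtain ⟨j, rfl⟩ := hk
    exact Finset.mem_image_of_mem _ (by simp)

theorem IsPCSystem.pcl_support {n t : ℕ} {s : V2 n → Bool} {c : V2 n → V2 n → ℕ}
    {H : SimpleGraph (V2 n)} (hH : IsPCSystem s c t H) (hsym : ∀ u v, c u v = c v u)
    {a b : V2 n} {p : H.Walk a b} (hp : p.IsPath) : PCL n c p.support := by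
  induction p with
  | nil => trivial
  | cons h q ih =>
    have hq := ih hp.of_cons
    cases q with
    | nil => trivial
    | cons h' r =>
      rename_i x _ y z
      simp only [Walk.support_cons] at hq ⊢
      rw [← Walk.cons_tail_support r] at hq ⊢
      refine ⟨?_, hq⟩
      rw [hsym]
      refine hH.pc _ _ _ h.symm h' ?_
      rintro rfl
      have := ((Walk.cons_isPath_iff _ _).1 hp).2
      simp at this

theorem IsPCSystem.isPCPath_support {n t : ℕ} {c : V2 n → V2 n → ℕ} {H : SimpleGraph (V2 n)}
    (hH : IsPCSystem Sum.isLeft c t H) (hsym : ∀ u v, c u v = c v u)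
    {a b : V2 n} {p : H.Walk a b} (hp : p.IsPath) : IsPCPath n c p.support := by
  refine ⟨p.support_ne_nil, hp.support_nodup, ?_, hH.pcl_support hsym hp⟩
  refine p.isChain_adj_support.imp fun u v h => ?_
  have := hH.bip _ _ h
  rcases u with u | u <;> rcases v with v | v <;> simp_all [KBB]

/-- Corollary 2.2.  Let `t ≥ 3`.  If `δ^c(K_{n,n}) ≥ 2n/3 + t`, then the
vertex set of `K_{n,n}` can be covered by at most `⌈2n/t⌉` pairwise vertex-disjoint
properly colored odd paths. -/
theorem cover_by_pc_odd_paths (n t : ℕ) (ht : 3 ≤ t)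
    (c : V2 n → V2 n → ℕ) (hsym : ∀ u v, c u v = c v u)
    (hdeg : ∀ v, (2 * n : ℝ) / 3 + t ≤ (colorDeg n c v : ℝ)) :
    ∃ F : Finset (List (V2 n)),
      (F.card : ℤ) ≤ ⌈(2 * (n : ℝ)) / (t : ℝ)⌉ ∧
      (∀ l ∈ F, IsPCOddPath n c l) ∧
      (∀ l ∈ F, ∀ l' ∈ F, l ≠ l' → ∀ v : V2 n, v ∈ l → v ∉ l') ∧
      (∀ v : V2 n, ∃ l ∈ F, v ∈ l) := by
  classical
  obtain ⟨H, hH, hdef⟩ := exists_isPCSystem_two_regular (s := (Sum.isLeft : V2 n → Bool)) (c := c)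
    (n := n) (D := (2 * n + 3 * t + 2) / 3) ht
    (fun v => by convert card_filter_isLeft_ne n v)
    (fun v => by
      have h₁ : ((2 * n + 3 * t : ℕ) : ℝ) ≤ ((3 * colorDeg n c v : ℕ) : ℝ) := by
        push_cast
        linarith [hdeg v]
      have h₂ := Nat.cast_le.1 h₁
      have h₃ : (2 * n + 3 * t + 2) / 3 ≤ colorDeg n c v := by omega
      convert h₃.trans (colorDeg_le_card_image n c v))
    (by omega)
  obtain ⟨F, hcard, hpath, hdisj, hcov⟩ := hH.exists_path_partition hdef
  refine ⟨F, ?_, fun l hl => ?_, hdisj, hcov⟩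
  · have h : ((F.card : ℤ) : ℝ) ≤ 2 * (n : ℝ) / (t : ℝ) := by
      rw [le_div_iff₀ (by positivity)]
      rw [Fintype.card_sum, Fintype.card_fin, ← two_mul] at hcard
      exact_mod_cast hcard
    exact Int.cast_le.1 (h.trans (Int.le_ceil _))
  · obtain ⟨a, b, p, hp, rfl, he⟩ := hpath l hl
    exact ⟨hH.isPCPath_support hsym hp, he⟩
end

section
/- If K^c_{n,n} is an edge-colored complete balanced bipartite graph with minimum color degree δ^c(K^c_{n,n}) ≥ n/2 + 1, then every vertex of K^c_{n,n} is contained in a properly colored cycle of length 4. -/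
open SimpleGraph

/-- A function that is constant off `s` takes at most `#s + 1` values. -/
lemma card_image_univ_le_card_add_one {α γ : Type*} [Fintype α] [DecidableEq γ]
    (f : α → γ) (k : γ) (s : Finset α) (h : ∀ a, a ∉ s → f a = k) :
    (Finset.univ.image f).card ≤ s.card + 1 := by
  have hsub : Finset.univ.image f ⊆ insert k (s.image f) := by
    intro z hz
    obtain ⟨a, -, rfl⟩ := Finset.mem_image.1 hz
    by_cases ha : a ∈ s
    · exact Finset.mem_insert_of_mem (Finset.mem_image_of_mem f ha)
    · exact Finset.mem_insert.2 (Or.inl (h a ha))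
  calc _ ≤ _ := Finset.card_le_card hsub
    _ ≤ (s.image f).card + 1 := Finset.card_insert_le _ _
    _ ≤ s.card + 1 := Nat.add_le_add_right Finset.card_image_le 1

/-- A square matrix whose rows and columns each have at least `n / 2 + 1` distinct entries
contains, for every row `x`, a `2 × 2` submatrix meeting row `x` in which adjacent entries
differ. -/
lemma exists_alternating_square {n : ℕ} {γ : Type*} [DecidableEq γ] (a : Fin n → Fin n → γ)
    (hrow : ∀ x, n + 2 ≤ 2 * (Finset.univ.image fun y => a x y).card)
    (hcol : ∀ y, n + 2 ≤ 2 * (Finset.univ.image fun x => a x y).card) (x : Fin n) :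
    ∃ x' y y', a x y ≠ a x y' ∧ a x y' ≠ a x' y' ∧ a x' y' ≠ a x' y ∧ a x' y ≠ a x y := by
  by_contra! hno
  -- `a x` or `a x'` is constant on the set of columns where they differ, which bounds its size
  have hA : ∀ x', 2 * (Finset.univ.filter fun y => a x' y ≠ a x y).card ≤ n := by
    intro x'
    set A := Finset.univ.filter fun y => a x' y ≠ a x y with hAdef
    have memA : ∀ y, y ∈ A ↔ a x' y ≠ a x y := by simp [hAdef]
    have hcard : A.card + Aᶜ.card = n := by simp
    have hconst : ∀ z, (∃ k, ∀ y ∈ A, a z y = k) → 2 * A.card ≤ n := by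
      rintro z ⟨k, hk⟩
      have h := card_image_univ_le_card_add_one (a z) k Aᶜ fun y hy => hk y (by simpa using hy)
      have : n + 2 ≤ 2 * (Finset.univ.image (a z)).card := hrow z
      omega
    by_cases hx : ∃ k, ∀ y ∈ A, a x y = k
    · exact hconst x hx
    · push Not at hx
      obtain ⟨y₀, hy₀, -⟩ := hx (a x x)
      obtain ⟨y₁, hy₁, hne⟩ := hx (a x y₀)
      have key : ∀ y ∈ A, ∀ y' ∈ A, a x y ≠ a x y' → a x' y' = a x' y := by
        intro y hy y' hy' h
        by_contra h'
        exact (memA y).1 hy (hno x' y y' h ((memA y').1 hy').symm h')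
      refine hconst x' ⟨a x' y₀, fun y hy => ?_⟩
      by_cases h : a x y = a x y₀
      · rw [key y₁ hy₁ y hy (by rw [h]; exact hne), key y₀ hy₀ y₁ hy₁ hne.symm]
      · exact key y₀ hy₀ y hy (Ne.symm h)
  have hS : ∀ y, n ≤ 2 * (Finset.univ.filter fun x' => a x' y ≠ a x y).card := by
    intro y
    have h := card_image_univ_le_card_add_one (fun x' => a x' y) (a x y)
      (Finset.univ.filter fun x' => a x' y ≠ a x y) (by simp)
    have := hcol y
    omega
  have hdouble := Finset.sum_card_bipartiteAbove_eq_sum_card_bipartiteBelow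
    (s := Finset.univ) (t := Finset.univ) (fun x' y : Fin n => a x' y ≠ a x y)
  simp only [Finset.bipartiteAbove, Finset.bipartiteBelow] at hdouble
  have hlt : ∑ x' : Fin n, 2 * (Finset.univ.filter fun y => a x' y ≠ a x y).card
      < ∑ _x' : Fin n, n :=
    Finset.sum_lt_sum (fun x' _ => hA x') ⟨x, Finset.mem_univ x, by simpa using x.pos⟩
  have hle : ∑ _y : Fin n, n
      ≤ ∑ y : Fin n, 2 * (Finset.univ.filter fun x' => a x' y ≠ a x y).card :=
    Finset.sum_le_sum fun y _ => hS y
  rw [← Finset.mul_sum] at hlt hle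
  omega

/-- Four cyclically adjacent vertices whose consecutive edges have distinct colors form a
properly colored 4-cycle. -/
lemma isPCCycle_four {n : ℕ} {c : V2 n → V2 n → ℕ} {p q r s : V2 n} (hpr : p ≠ r) (hqs : q ≠ s)
    (hpq : (KBB n).Adj p q) (hqr : (KBB n).Adj q r) (hrs : (KBB n).Adj r s)
    (hsp : (KBB n).Adj s p) (h₀ : c p q ≠ c q r) (h₁ : c q r ≠ c r s) (h₂ : c r s ≠ c s p)
    (h₃ : c s p ≠ c p q) : IsPCCycle n c 4 (![p, q, r, s] : Fin 4 → V2 n) := by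
  refine ⟨?_, ?_, ?_⟩
  · change Function.Injective (![p, q, r, s] : Fin 4 → V2 n)
    have := hpq.ne
    have := hqr.ne
    have := hrs.ne
    have := hsp.ne
    intro i j hij
    fin_cases i <;> fin_cases j <;> simp_all
  · intro i
    change Fin 4 at i
    fin_cases i
    exacts [hpq, hqr, hrs, hsp]
  · intro i
    change Fin 4 at i
    fin_cases i
    exacts [h₀, h₁, h₂, h₃]

/-- Theorem 1.2.  If `δ^c(K_{n,n}) ≥ n/2 + 1`, then every vertex of
`K_{n,n}` is contained in a properly colored 4-cycle. -/
theorem pc_four_cycle_through_every_vertex (n : ℕ)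
    (c : V2 n → V2 n → ℕ) (hsym : ∀ u v, c u v = c v u)
    (hdeg : ∀ v, (n : ℝ) / 2 + 1 ≤ (colorDeg n c v : ℝ)) :
    ∀ u : V2 n, ∃ f : ZMod 4 → V2 n, IsPCCycle n c 4 f ∧ ∃ i, f i = u := by
  have hnat : ∀ v, n + 2 ≤ 2 * colorDeg n c v := by
    intro v
    have h : (n : ℝ) + 2 ≤ 2 * (colorDeg n c v : ℝ) := by linarith [hdeg v]
    exact_mod_cast h
  have hX : ∀ x : Fin n, n + 2 ≤
      2 * (Finset.univ.image fun y : Fin n => c (Sum.inl x) (Sum.inr y)).card :=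
    fun x => hnat (Sum.inl x)
  have hY : ∀ y : Fin n, n + 2 ≤
      2 * (Finset.univ.image fun x : Fin n => c (Sum.inr y) (Sum.inl x)).card :=
    fun y => hnat (Sum.inr y)
  rintro (x | y)
  · obtain ⟨x', y, y', h₃, h₀, h₁, h₂⟩ := exists_alternating_square
      (fun x y => c (Sum.inl x) (Sum.inr y)) hX (by simpa only [hsym (Sum.inr _)] using hY) x
    have hcyc := isPCCycle_four (c := c) (p := Sum.inl x) (q := Sum.inr y') (r := Sum.inl x')
      (s := Sum.inr y) (by rintro ⟨⟩; exact h₀ rfl) (by rintro ⟨⟩; exact h₁ rfl)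
      (by simp [KBB]) (by simp [KBB]) (by simp [KBB]) (by simp [KBB])
      (by rwa [hsym (Sum.inr y')]) (by rwa [hsym (Sum.inr y')]) (by rwa [hsym (Sum.inr y)])
      (by rwa [hsym (Sum.inr y)])
    exact ⟨_, hcyc, 0, rfl⟩
  · obtain ⟨y', x, x', h₃, h₀, h₁, h₂⟩ := exists_alternating_square
      (fun y x => c (Sum.inr y) (Sum.inl x)) hY (by simpa only [hsym (Sum.inr _)] using hX) y
    have hcyc := isPCCycle_four (c := c) (p := Sum.inr y) (q := Sum.inl x') (r := Sum.inr y')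
      (s := Sum.inl x) (by rintro ⟨⟩; exact h₀ rfl) (by rintro ⟨⟩; exact h₁ rfl)
      (by simp [KBB]) (by simp [KBB]) (by simp [KBB]) (by simp [KBB])
      (by rwa [hsym (Sum.inl x')]) (by rwa [hsym (Sum.inl x')]) (by rwa [hsym (Sum.inl x)])
      (by rwa [hsym (Sum.inl x)])
    exact ⟨_, hcyc, 0, rfl⟩
end

section
/- Let ε > 0 and let K^c_{n,n} be an edge-colored complete balanced bipartite graph with parts X and Y satisfying δ^c(K^c_{n,n}) ≥ (2/3 + ε)n and n ≥ 4/ε. Then for every pair (x, y) with x ∈ X and y ∈ Y, the number of absorbing paths for (x, y) is at least (16/9)ε² n⁴. -/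
open SimpleGraph

/-- Forbidding the colors in `S` loses at most `S.card` colors. -/
lemma card_image_le_card_filter_notMem_add_card {α β : Type*} [Fintype α] [DecidableEq β]
    (f : α → β) (S : Finset β) :
    (Finset.univ.image f).card ≤ (Finset.univ.filter fun j => f j ∉ S).card + S.card := by
  have h : Finset.univ.image f ⊆ (Finset.univ.filter fun j => f j ∉ S).image f ∪ S := by
    intro k hk
    obtain ⟨j, -, rfl⟩ := Finset.mem_image.1 hk
    by_cases hj : f j ∈ S
    · exact Finset.mem_union_right _ hj
    · exact Finset.mem_union_left _ (Finset.mem_image_of_mem f (by simpa using hj))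
  calc (Finset.univ.image f).card
      ≤ ((Finset.univ.filter fun j => f j ∉ S).image f ∪ S).card := Finset.card_le_card h
    _ ≤ _ := (Finset.card_union_le _ _).trans (Nat.add_le_add_right Finset.card_image_le _)

/-- Counting quadruples by choosing the two inner vertices first and then the outer ones. -/
lemma mul_pow_le_ncard_of_inner_outer {α : Type*} [Fintype α] (Q : Set (α × α × α × α))
    (B A : Finset α) (N M : α → α → Finset α) (r : ℝ) (hr : 0 ≤ r)
    (hB : r ≤ B.card) (hA : r ≤ A.card)
    (hN : ∀ b a, r ≤ (N b a).card) (hM : ∀ b a, r ≤ (M b a).card)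
    (hQ : ∀ b ∈ B, ∀ a ∈ A, ∀ a' ∈ N b a, ∀ b' ∈ M b a, (a', b, a, b') ∈ Q) :
    r ^ 4 ≤ (Q.ncard : ℝ) := by
  let F : Finset (Σ _ : α × α, α × α) := (B ×ˢ A).sigma fun p => N p.1 p.2 ×ˢ M p.1 p.2
  have hF : r ^ 4 ≤ (F.card : ℝ) := by
    rw [Finset.card_sigma]
    push_cast [Finset.card_product]
    have h₁ : ((B ×ˢ A).card : ℝ) * (r * r) ≤
        ∑ p ∈ B ×ˢ A, ((N p.1 p.2).card : ℝ) * ((M p.1 p.2).card : ℝ) := by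
      rw [← nsmul_eq_mul]
      exact Finset.card_nsmul_le_sum _ _ _ fun p _ =>
        mul_le_mul (hN _ _) (hM _ _) hr (Nat.cast_nonneg _)
    refine le_trans ?_ h₁
    rw [Finset.card_product, Nat.cast_mul]
    calc r ^ 4 = (r * r) * (r * r) := by ring
      _ ≤ _ := by gcongr
  refine hF.trans (Nat.cast_le.2 ?_)
  rw [← Set.ncard_coe_finset]
  refine Set.ncard_le_ncard_of_injOn (fun s => (s.2.1, s.1.1, s.1.2, s.2.2)) ?_ ?_ Q.toFinite
  · rintro ⟨⟨b, a⟩, a', b'⟩ h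
    simp only [F, Finset.mem_coe, Finset.mem_sigma, Finset.mem_product] at h
    exact hQ b h.1.1 a h.1.2 a' h.2.1 b' h.2.2
  · rintro ⟨⟨b, a⟩, a', b'⟩ - ⟨⟨b₁, a₁⟩, a₁', b₁'⟩ - h
    simp only [Prod.mk.injEq] at h
    obtain ⟨rfl, rfl, rfl, rfl⟩ := h
    rfl

/-- Lemma 3.4 (i).  If `δ^c(K_{n,n}) ≥ (2/3 + ε)n` and `n ≥ 4/ε`, then for
every `x ∈ X`, `y ∈ Y` the number of absorbing paths for `(x, y)` is at least
`(16/9)ε²n⁴`. -/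
theorem count_absorbing_paths_pair (n : ℕ) (ε : ℝ) (hε : 0 < ε)
    (c : V2 n → V2 n → ℕ) (hsym : ∀ u v, c u v = c v u)
    (hdeg : ∀ v, ((2 : ℝ) / 3 + ε) * n ≤ (colorDeg n c v : ℝ))
    (hn : (4 : ℝ) / ε ≤ (n : ℝ)) (x y : Fin n) :
    (16 : ℝ) / 9 * ε ^ 2 * (n : ℝ) ^ 4 ≤
      (({P : Fin n × Fin n × Fin n × Fin n | IsAbsorbingPath1 n c x y P}).ncard : ℝ) := by
  have hn0 : (0 : ℝ) < n := Nat.cast_pos.2 x.pos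
  have hεn : 4 ≤ ε * n := by rwa [div_le_iff₀' hε] at hn
  have hε3 : ε ≤ 1 / 3 := by
    have h₁ : (colorDeg n c (Sum.inl x) : ℝ) ≤ n := by
      exact_mod_cast Finset.card_image_le.trans (Finset.card_fin n).le
    have h₂ := (hdeg (Sum.inl x)).trans h₁
    by_contra! h
    nlinarith
  let L (a : Fin n) (S : Finset ℕ) : Finset (Fin n) :=
    Finset.univ.filter fun j => c (Sum.inl a) (Sum.inr j) ∉ S
  let R (b : Fin n) (S : Finset ℕ) : Finset (Fin n) :=
    Finset.univ.filter fun i => c (Sum.inr b) (Sum.inl i) ∉ S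
  have hL (a : Fin n) (S : Finset ℕ) (hS : S.card ≤ 2) : 2 / 3 * (n : ℝ) ≤ (L a S).card := by
    have h₁ : (colorDeg n c (Sum.inl a) : ℝ) ≤ (L a S).card + S.card := by
      exact_mod_cast card_image_le_card_filter_notMem_add_card
        (fun j => c (Sum.inl a) (Sum.inr j)) S
    have h₂ : (S.card : ℝ) ≤ 2 := by exact_mod_cast hS
    linarith [hdeg (Sum.inl a)]
  have hR (b : Fin n) (S : Finset ℕ) (hS : S.card ≤ 2) : 2 / 3 * (n : ℝ) ≤ (R b S).card := by
    have h₁ : (colorDeg n c (Sum.inr b) : ℝ) ≤ (R b S).card + S.card := by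
      exact_mod_cast card_image_le_card_filter_notMem_add_card
        (fun i => c (Sum.inr b) (Sum.inl i)) S
    have h₂ : (S.card : ℝ) ≤ 2 := by exact_mod_cast hS
    linarith [hdeg (Sum.inr b)]
  have hcount := mul_pow_le_ncard_of_inner_outer
    {P : Fin n × Fin n × Fin n × Fin n | IsAbsorbingPath1 n c x y P}
    (L x {c (Sum.inl x) (Sum.inr y)}) (R y {c (Sum.inl x) (Sum.inr y)})
    (fun b a => R b {c (Sum.inr b) (Sum.inl a), c (Sum.inr b) (Sum.inl x)})
    (fun b a => L a {c (Sum.inr b) (Sum.inl a), c (Sum.inr y) (Sum.inl a)})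
    (2 / 3 * n) (by positivity) (hL _ _ (by simp)) (hR _ _ (by simp))
    (fun _ _ => hR _ _ Finset.card_le_two) (fun _ _ => hL _ _ Finset.card_le_two) (by
      intro b hb a ha a' ha' b' hb'
      simp only [L, R, Finset.mem_filter, Finset.mem_univ, true_and, Finset.mem_insert,
        Finset.mem_singleton, not_or] at hb ha ha' hb'
      simp only [Set.mem_ofPred_eq, IsAbsorbingPath1, IsPC3Path]
      grind)
  have hε2 : ε ^ 2 ≤ 1 / 9 := by nlinarith
  calc (16 : ℝ) / 9 * ε ^ 2 * (n : ℝ) ^ 4 ≤ 16 / 9 * (1 / 9) * (n : ℝ) ^ 4 := by gcongr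
    _ = (2 / 3 * (n : ℝ)) ^ 4 := by ring
    _ ≤ _ := hcount
end
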